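/- arXiv:2603.06417 — 2 statements merged into one kernel-verified Lean document; each statement's English description precedes it below -/
import Mathlib

section
/- Assume conditions (V) and (Q) with α ≤ N < β, and let 2 ≤ p ≤ 2*_γ. Then there exists a constant C > 0 such that for every u ∈ C_c^∞(ℝ^N), (∫_{ℝ^N} Q(z)|u|^p dz)^{1/p} ≤ C ‖u‖_{E_V^γ}; that is, the embedding E_V^γ ↪ L^p_Q(ℝ^N) is continuous. -/
open MeasureTheory Filter

noncomputable section

/-- `ℝ^m` with its Euclidean structure. -/
abbrev Em (m : ℕ) : Type := EuclideanSpace ℝ (Fin m)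

/-- Gradient in the `x`-variables. -/
noncomputable def gradX {m k : ℕ} (u : Em m × Em k → ℝ) (z : Em m × Em k) : Em m :=
  gradient (fun x => u (x, z.2)) z.1

/-- Gradient in the `y`-variables. -/
noncomputable def gradY {m k : ℕ} (u : Em m × Em k → ℝ) (z : Em m × Em k) : Em k :=
  gradient (fun y => u (z.1, y)) z.2

/-- The Grushin gradient `∇_γ u (x,y) = (∇_x u, |x|^γ ∇_y u)`. -/
noncomputable def grushinGrad {m k : ℕ} (γ : ℝ) (u : Em m × Em k → ℝ) (z : Em m × Em k) :
    Em m × Em k :=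
  (gradX u z, ‖z.1‖ ^ γ • gradY u z)

/-- `|∇_γ u|² = |∇_x u|² + |x|^{2γ} |∇_y u|²`. -/
noncomputable def grushinSq {m k : ℕ} (γ : ℝ) (u : Em m × Em k → ℝ) (z : Em m × Em k) : ℝ :=
  ‖gradX u z‖ ^ 2 + ‖z.1‖ ^ (2 * γ) * ‖gradY u z‖ ^ 2

/-- The Euclidean norm of `z = (x,y) ∈ ℝ^m × ℝ^k ≅ ℝ^N`. -/
noncomputable def pnorm {m k : ℕ} (z : Em m × Em k) : ℝ :=
  Real.sqrt (‖z.1‖ ^ 2 + ‖z.2‖ ^ 2)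

/-- The Euclidean ball `B_R = {z : |z| < R}` in `ℝ^m × ℝ^k ≅ ℝ^N`. -/
def pball (m k : ℕ) (R : ℝ) : Set (Em m × Em k) := {z | pnorm z < R}

/-- The critical exponent `2*_γ = 2 N_γ / (N_γ - 2)`, `N_γ = m + (γ+1)k`. -/
noncomputable def twoStar (m k : ℕ) (γ : ℝ) : ℝ :=
  2 * ((m : ℝ) + (γ + 1) * k) / (((m : ℝ) + (γ + 1) * k) - 2)

/-- The norm of the space `E_V^γ`:
`‖u‖ = (∫ (|∇_γ u|² + V u²))^{1/2}` (with value `0` if the integral is infinite). -/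
noncomputable def enormV {m k : ℕ} (γ : ℝ) (V u : Em m × Em k → ℝ) : ℝ :=
  ((∫⁻ z, ENNReal.ofReal (grushinSq γ u z + V z * u z ^ 2)) ^ ((1:ℝ)/2)).toReal

open scoped ENNReal

/-- Translating a `C^1` function by `h` costs at most the `L²` norm of its derivative along `h`,
also for weights that are invariant under translation along `h`. -/
theorem lintegral_enorm_translate_sub_sq_le {E : Type*} [NormedAddCommGroup E] [NormedSpace ℝ E]
    [MeasurableSpace E] [BorelSpace E] (μ : Measure E) [SFinite μ]
    [μ.IsAddRightInvariant] {v : E → ℝ} (hv : ContDiff ℝ 1 v) {w : E → ℝ≥0∞} (hw : Measurable w)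
    (h : E) (hwh : ∀ z (τ : ℝ), w (z + τ • h) = w z) :
    ∫⁻ z, w z * ‖v (z + h) - v z‖ₑ ^ 2 ∂μ ≤ ∫⁻ z, w z * ‖fderiv ℝ v z h‖ₑ ^ 2 ∂μ := by
  have hcont : Continuous (fun z => fderiv ℝ v z h) :=
    (hv.continuous_fderiv one_ne_zero).clm_apply continuous_const
  have key : ∀ z, ‖v (z + h) - v z‖ₑ ^ 2
      ≤ ∫⁻ τ in Set.Ioc (0:ℝ) 1, ‖fderiv ℝ v (z + τ • h) h‖ₑ ^ 2 := by
    intro z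
    have hline : Continuous (fun τ : ℝ => fderiv ℝ v (z + τ • h) h) :=
      hcont.comp (by fun_prop)
    have hder : ∀ τ : ℝ, HasDerivAt (fun τ : ℝ => v (z + τ • h)) (fderiv ℝ v (z + τ • h) h) τ := by
      intro τ
      have h1 : HasDerivAt (fun τ : ℝ => z + τ • h) h τ := by
        simpa using ((hasDerivAt_id τ).smul_const h).const_add z
      exact ((hv.differentiable one_ne_zero _).hasFDerivAt).comp_hasDerivAt τ h1
    have hftc := intervalIntegral.integral_eq_sub_of_hasDerivAt (a := 0) (b := 1)
      (fun τ _ => hder τ) (hline.intervalIntegrable _ _)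
    simp only [one_smul, zero_smul, add_zero] at hftc
    rw [← hftc, intervalIntegral.integral_of_le zero_le_one]
    have h2 : ‖∫ τ in Set.Ioc (0:ℝ) 1, fderiv ℝ v (z + τ • h) h‖ₑ
        ≤ ∫⁻ τ in Set.Ioc (0:ℝ) 1, ‖fderiv ℝ v (z + τ • h) h‖ₑ :=
      enorm_integral_le_lintegral_enorm _
    have h3 := ENNReal.lintegral_mul_le_Lp_mul_Lq (volume.restrict (Set.Ioc (0:ℝ) 1))
      (p := 2) (q := 2) Real.HolderConjugate.two_two
      (f := fun τ => ‖fderiv ℝ v (z + τ • h) h‖ₑ) (g := fun _ => 1)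
      hline.measurable.enorm.aemeasurable aemeasurable_const
    simp only [Pi.mul_apply, mul_one, one_pow, ENNReal.one_rpow, lintegral_const,
      Measure.restrict_apply MeasurableSet.univ, Set.univ_inter, Real.volume_Ioc, sub_zero,
      ENNReal.ofReal_one, ENNReal.rpow_ofNat] at h3
    calc _ ≤ ((∫⁻ τ in Set.Ioc (0:ℝ) 1, ‖fderiv ℝ v (z + τ • h) h‖ₑ ^ 2) ^ (1 / 2 : ℝ)) ^ 2 :=
          pow_le_pow_left' (h2.trans h3) 2
      _ = _ := by
          rw [← ENNReal.rpow_natCast, ← ENNReal.rpow_mul]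
          norm_num
  have hmeas : Measurable (Function.uncurry fun (z : E) (τ : ℝ) =>
      w z * ‖fderiv ℝ v (z + τ • h) h‖ₑ ^ 2) := by
    refine (hw.comp measurable_fst).mul (Measurable.pow_const ?_ 2)
    exact (hcont.comp (by fun_prop : Continuous fun p : E × ℝ => p.1 + p.2 • h)).measurable.enorm
  calc ∫⁻ z, w z * ‖v (z + h) - v z‖ₑ ^ 2 ∂μ
      ≤ ∫⁻ z, (∫⁻ τ in Set.Ioc (0:ℝ) 1, w z * ‖fderiv ℝ v (z + τ • h) h‖ₑ ^ 2) ∂μ := by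
        refine lintegral_mono fun z => ?_
        rw [lintegral_const_mul]
        · gcongr
          exact key z
        · exact Measurable.pow_const
            (hcont.comp (by fun_prop : Continuous fun τ : ℝ => z + τ • h)).measurable.enorm 2
    _ = ∫⁻ τ in Set.Ioc (0:ℝ) 1, ∫⁻ z, w z * ‖fderiv ℝ v (z + τ • h) h‖ₑ ^ 2 ∂μ :=
        lintegral_lintegral_swap hmeas.aemeasurable
    _ = ∫⁻ τ in Set.Ioc (0:ℝ) 1, ∫⁻ z, w z * ‖fderiv ℝ v z h‖ₑ ^ 2 ∂μ := by
        refine lintegral_congr fun τ => ?_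
        rw [← lintegral_add_right_eq_self (fun z => w z * ‖fderiv ℝ v z h‖ₑ ^ 2) (τ • h)]
        simp only [hwh]
    _ = _ := by simp

/-- A smooth cutoff between the levels `|s| ≤ 1` and `|s| ≥ 2`. -/
theorem exists_contDiff_level_cutoff : ∃ (ψ : ℝ → ℝ) (M : ℝ), 0 < M ∧ ContDiff ℝ 1 ψ ∧
    (∀ s, |s| ≤ 1 → ψ s = 0) ∧ (∀ s, 2 ≤ |s| → ψ s = 1) ∧
    ∀ s, |deriv ψ s| ≤ (Set.Ioo 1 2).indicator (fun _ => M) |s| := by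
  set ψ : ℝ → ℝ := fun s => Real.smoothTransition (s ^ 2 - 1) with hψ
  have hsm : ContDiff ℝ 1 ψ := by
    have := (Real.smoothTransition.contDiff (n := 1)).comp
      (by fun_prop : ContDiff ℝ 1 fun s : ℝ => s ^ 2 - 1)
    exact_mod_cast this
  have h0 : ∀ s, |s| ≤ 1 → ψ s = 0 := fun s hs =>
    Real.smoothTransition.zero_of_nonpos (by nlinarith [sq_abs s, abs_nonneg s])
  have h1 : ∀ s, 2 ≤ |s| → ψ s = 1 := fun s hs =>
    Real.smoothTransition.one_of_one_le (by nlinarith [sq_abs s, abs_nonneg s])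
  obtain ⟨M, hM⟩ := (isCompact_Icc (a := (-2:ℝ)) (b := 2)).exists_bound_of_continuousOn
    (hsm.continuous_deriv le_rfl).continuousOn
  refine ⟨ψ, max M 1, by positivity, hsm, h0, h1, fun s => ?_⟩
  by_cases hs : |s| ∈ Set.Ioo 1 2
  · rw [Set.indicator_of_mem hs]
    exact (hM s (by rw [Set.mem_Icc, ← abs_le]; exact hs.2.le)).trans (le_max_left _ _)
  · rw [Set.indicator_of_notMem hs, abs_nonpos_iff]
    rw [Set.mem_Ioo, not_and_or, not_lt, not_lt] at hs
    rcases hs with hs | hs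
    · refine IsLocalMin.deriv_eq_zero (Eventually.of_forall fun x => ?_)
      rw [h0 s hs]
      exact Real.smoothTransition.nonneg _
    · refine IsLocalMax.deriv_eq_zero (Eventually.of_forall fun x => ?_)
      rw [h1 s hs]
      exact Real.smoothTransition.le_one _

/-- The derivative in a direction `(h, 0)` is bounded by the gradient in `x`. -/
theorem enorm_fderiv_inl_le {m k : ℕ} {u : Em m × Em k → ℝ} (hu : ContDiff ℝ 1 u)
    (z : Em m × Em k) (h : Em m) :
    ‖fderiv ℝ u z (h, 0)‖ₑ ≤ ‖gradX u z‖ₑ * ‖h‖ₑ := by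
  have h1 : HasFDerivAt (fun x => u (x, z.2))
      ((fderiv ℝ u z).comp (ContinuousLinearMap.inl ℝ (Em m) (Em k))) z.1 :=
    HasFDerivAt.comp z.1 (g := u) (f := fun x => (x, z.2))
      (hu.differentiable one_ne_zero _).hasFDerivAt (hasFDerivAt_prodMk_left z.1 z.2)
  have h2 : fderiv ℝ u z (h, 0) = inner ℝ (gradX u z) h := by
    rw [gradX, inner_gradient_left, h1.fderiv]
    simp
  rw [h2, ← ofReal_norm, ← ofReal_norm, ← ofReal_norm,
    ← ENNReal.ofReal_mul (norm_nonneg _)]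
  exact ENNReal.ofReal_le_ofReal (norm_inner_le_norm _ _)

/-- The derivative in a direction `(0, h)` is bounded by the gradient in `y`. -/
theorem enorm_fderiv_inr_le {m k : ℕ} {u : Em m × Em k → ℝ} (hu : ContDiff ℝ 1 u)
    (z : Em m × Em k) (h : Em k) :
    ‖fderiv ℝ u z (0, h)‖ₑ ≤ ‖gradY u z‖ₑ * ‖h‖ₑ := by
  have h1 : HasFDerivAt (fun y => u (z.1, y))
      ((fderiv ℝ u z).comp (ContinuousLinearMap.inr ℝ (Em m) (Em k))) z.2 :=
    HasFDerivAt.comp z.2 (g := u) (f := fun y => (z.1, y))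
      (hu.differentiable one_ne_zero _).hasFDerivAt (hasFDerivAt_prodMk_right z.1 z.2)
  have h2 : fderiv ℝ u z (0, h) = inner ℝ (gradY u z) h := by
    rw [gradY, inner_gradient_left, h1.fderiv]
    simp
  rw [h2, ← ofReal_norm, ← ofReal_norm, ← ofReal_norm,
    ← ENNReal.ofReal_mul (norm_nonneg _)]
  exact ENNReal.ofReal_le_ofReal (norm_inner_le_norm _ _)

instance volume_prod_isAddHaarMeasure (m k : ℕ) :
    (volume : Measure (Em m × Em k)).IsAddHaarMeasure :=
  inferInstanceAs ((volume : Measure (Em m)).prod (volume : Measure (Em k))).IsAddHaarMeasure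

/-- The translation estimate for a cutoff of `u` between the levels `t` and `2 t` only sees the
derivative of `u` on the region between these levels. -/
theorem lintegral_enorm_translate_cutoff_sub_sq_le {E : Type*} [NormedAddCommGroup E]
    [NormedSpace ℝ E] [MeasurableSpace E] [BorelSpace E] (μ : Measure E)
    [SFinite μ] [μ.IsAddRightInvariant] {u : E → ℝ} (hu : ContDiff ℝ 1 u) {ψ : ℝ → ℝ} {M t : ℝ}
    (hψ : ContDiff ℝ 1 ψ) (hψM : ∀ s, |deriv ψ s| ≤ (Set.Ioo 1 2).indicator (fun _ => M) |s|)
    (ht : 0 < t) {w : E → ℝ≥0∞} (hw : Measurable w) (d : E)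
    (hwd : ∀ z (τ : ℝ), w (z + τ • d) = w z) {g : E → ℝ≥0∞} {c : ℝ≥0∞} (hc : c ≠ ∞)
    (hg : ∀ z, ‖fderiv ℝ u z d‖ₑ ≤ g z * c) :
    ∫⁻ z, w z * ‖ψ (u (z + d) / t) - ψ (u z / t)‖ₑ ^ 2 ∂μ
      ≤ (c * ENNReal.ofReal (M / t)) ^ 2 *
        ∫⁻ z in {z | t < |u z| ∧ |u z| < 2 * t}, w z * g z ^ 2 ∂μ := by
  have hv : ContDiff ℝ 1 (fun z => ψ (u z / t)) := hψ.comp (hu.div_const t)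
  have hA : MeasurableSet {z | t < |u z| ∧ |u z| < 2 * t} :=
    ((isOpen_lt continuous_const hu.continuous.abs).inter
      (isOpen_lt hu.continuous.abs continuous_const)).measurableSet
  refine (lintegral_enorm_translate_sub_sq_le μ hv hw d hwd).trans ?_
  rw [← lintegral_indicator hA, ← lintegral_const_mul' _ _]
  swap
  · exact ENNReal.pow_ne_top (ENNReal.mul_ne_top hc ENNReal.ofReal_ne_top)
  refine lintegral_mono fun z => ?_
  have hder : fderiv ℝ (fun z => ψ (u z / t)) z d
      = deriv ψ (u z / t) * (fderiv ℝ u z d / t) := by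
    have h1 : HasFDerivAt (fun z => u z / t) (t⁻¹ • fderiv ℝ u z) z := by
      exact ((hu.differentiable one_ne_zero z).hasFDerivAt.const_smul t⁻¹).congr_of_eventuallyEq
        (Eventually.of_forall fun x => by simp [div_eq_inv_mul])
    have h2 := ((hψ.differentiable one_ne_zero (u z / t)).hasDerivAt).comp_hasFDerivAt z h1
    have h3 : HasFDerivAt (fun z => ψ (u z / t))
      (deriv ψ (u z / t) • t⁻¹ • fderiv ℝ u z) z := h2
    rw [h3.fderiv]
    simp [div_eq_inv_mul]
  have hM := hψM (u z / t)
  rw [abs_div, abs_of_pos ht] at hM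
  by_cases hz : z ∈ {z | t < |u z| ∧ |u z| < 2 * t}
  · have hz' : |u z| / t ∈ Set.Ioo 1 2 := by
      rw [Set.mem_Ioo, one_lt_div ht, div_lt_iff₀ ht]
      exact hz
    rw [Set.indicator_of_mem hz'] at hM
    rw [Set.indicator_of_mem hz, hder]
    have h1 : ‖deriv ψ (u z / t) * (fderiv ℝ u z d / t)‖ₑ
        ≤ c * ENNReal.ofReal (M / t) * g z := by
      calc ‖deriv ψ (u z / t) * (fderiv ℝ u z d / t)‖ₑ
          = ‖deriv ψ (u z / t) / t‖ₑ * ‖fderiv ℝ u z d‖ₑ := by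
            rw [← enorm_mul]
            congr 1
            ring
        _ ≤ ENNReal.ofReal (M / t) * (g z * c) := by
            refine mul_le_mul' ?_ (hg z)
            rw [← ofReal_norm, Real.norm_eq_abs, abs_div, abs_of_pos ht]
            exact ENNReal.ofReal_le_ofReal (by gcongr)
        _ = _ := by ring
    calc _ ≤ w z * (c * ENNReal.ofReal (M / t) * g z) ^ 2 := by gcongr
      _ = _ := by ring
  · have hz' : |u z| / t ∉ Set.Ioo 1 2 := by
      rw [Set.mem_Ioo, one_lt_div ht, div_lt_iff₀ ht]
      exact hz
    rw [Set.indicator_of_notMem hz', abs_nonpos_iff] at hM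
    simp [hder, hM]


theorem two_mul_ofReal (a : ℝ) : 2 * ENNReal.ofReal a = ENNReal.ofReal (2 * a) := by
  rw [ENNReal.ofReal_mul zero_le_two, ENNReal.ofReal_ofNat]

/-- Half-space level estimate: if the superlevel set `{|u| > t}` is small compared with an
anisotropic box of size `r`, then `{|u| > 2 t}` is controlled by the Grushin energy between the
two levels. -/
theorem volume_halfspace_level_le {m k : ℕ} {γ : ℝ} (hγ : 0 ≤ γ) {u : Em m × Em k → ℝ}
    (hu : ContDiff ℝ 1 u) {ψ : ℝ → ℝ} {M t r : ℝ} (hM : 0 < M) (hψ : ContDiff ℝ 1 ψ)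
    (hψ0 : ∀ s, |s| ≤ 1 → ψ s = 0) (hψ1 : ∀ s, 2 ≤ |s| → ψ s = 1)
    (hψM : ∀ s, |deriv ψ s| ≤ (Set.Ioo 1 2).indicator (fun _ => M) |s|)
    (ht : 0 < t) (hr : 0 < r) {e : Em m} (he : ‖e‖ = 1)
    (hvol : 2 * volume {z | t < |u z|}
      ≤ volume (Metric.ball ((2 * r) • e) r ×ˢ Metric.ball (0 : Em k) (r ^ (γ + 1)))) :
    volume {z : Em m × Em k | 2 * t < |u z| ∧ 0 ≤ inner ℝ e z.1}
      ≤ ENNReal.ofReal (36 * r ^ 2 * (M / t) ^ 2) *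
        ∫⁻ z in {z | t < |u z| ∧ |u z| < 2 * t}, ENNReal.ofReal (grushinSq γ u z) := by
  set K := Metric.ball ((2 * r) • e) r ×ˢ Metric.ball (0 : Em k) (r ^ (γ + 1)) with hK
  set D := {z : Em m × Em k | 2 * t < |u z| ∧ 0 ≤ inner ℝ e z.1} with hD
  set A := {z : Em m × Em k | t < |u z| ∧ |u z| < 2 * t} with hA
  set G := ∫⁻ z in A, ENNReal.ofReal (grushinSq γ u z) with hG
  set v : Em m × Em k → ℝ := fun z => ψ (u z / t) with hv
  have hvc : Continuous v := hψ.continuous.comp (hu.continuous.div_const t)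
  have hρ : 0 < r ^ (γ + 1) := Real.rpow_pos_of_pos hr _
  have hKpos : volume K ≠ 0 := by
    refine ((Metric.isOpen_ball.prod Metric.isOpen_ball).measure_pos volume ?_).ne'
    exact (Metric.nonempty_ball.2 hr).prod (Metric.nonempty_ball.2 hρ)
  have hKtop : volume K ≠ ∞ :=
    (Metric.isBounded_ball.prod Metric.isBounded_ball).measure_lt_top.ne
  have hKm : MeasurableSet K := measurableSet_ball.prod measurableSet_ball
  have hinner : Continuous fun z : Em m × Em k => (inner ℝ e z.1 : ℝ) :=
    continuous_const.inner continuous_fst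
  have hDm : MeasurableSet D :=
    (isOpen_lt continuous_const hu.continuous.abs).measurableSet.inter
      (isClosed_le continuous_const hinner).measurableSet
  have hlow : ∀ z ∈ D, volume K ≤ 2 * ∫⁻ d in K, ‖v (z + d) - v z‖ₑ ^ 2 := by
    intro z hz
    have hvz : v z = 1 := hψ1 _ (by
      rw [abs_div, abs_of_pos ht, le_div_iff₀ ht]
      exact hz.1.le)
    set B := {d : Em m × Em k | t < |u (z + d)|} with hB
    have hBm : MeasurableSet B := (isOpen_lt continuous_const
      (hu.continuous.comp (continuous_const.add continuous_id)).abs).measurableSet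
    have hBvol : volume B = volume {z | t < |u z|} :=
      measure_preimage_add volume z {z | t < |u z|}
    have h1 : volume (K \ B) ≤ ∫⁻ d in K, ‖v (z + d) - v z‖ₑ ^ 2 := by
      calc volume (K \ B) = ∫⁻ d in K \ B, 1 := by simp
        _ = ∫⁻ d in K \ B, ‖v (z + d) - v z‖ₑ ^ 2 := by
          refine setLIntegral_congr_fun (hKm.diff hBm) fun d hd => ?_
          have : v (z + d) = 0 := hψ0 _ (by
            rw [abs_div, abs_of_pos ht, div_le_one ht]
            exact not_lt.1 hd.2)
          simp [this, hvz]
        _ ≤ _ := lintegral_mono_set Set.sdiff_subset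
    have h2 : volume K ≤ volume B + volume (K \ B) := by
      refine (measure_mono ?_).trans (measure_union_le _ _)
      intro d hd
      by_cases hdB : d ∈ B
      · exact Or.inl hdB
      · exact Or.inr ⟨hd, hdB⟩
    have h3 : volume K + volume K ≤ volume K + 2 * volume (K \ B) := by
      calc volume K + volume K ≤ 2 * (volume B + volume (K \ B)) := by
            rw [← two_mul]; gcongr
        _ = 2 * volume B + 2 * volume (K \ B) := mul_add _ _ _
        _ ≤ _ := by rw [hBvol]; gcongr
    exact ((ENNReal.add_le_add_iff_left hKtop).1 h3).trans (by gcongr)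
  have hup : ∀ d ∈ K, ∫⁻ z in D, ‖v (z + d) - v z‖ₑ ^ 2
      ≤ ENNReal.ofReal (18 * r ^ 2 * (M / t) ^ 2) * G := by
    rintro ⟨h, l⟩ ⟨hh, hl⟩
    simp only [Metric.mem_ball, dist_eq_norm, sub_zero] at hh hl
    have hh3 : ‖h‖ ≤ 3 * r := by
      calc ‖h‖ = ‖(2 * r) • e + (h - (2 * r) • e)‖ := by congr 1; abel
        _ ≤ ‖(2 * r) • e‖ + ‖h - (2 * r) • e‖ := norm_add_le _ _
        _ ≤ 3 * r := by
          rw [norm_smul, he, Real.norm_eq_abs, abs_of_pos (by positivity)]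
          linarith
    have heh : r ≤ inner ℝ e h := by
      have h1 : inner ℝ e h = 2 * r + inner ℝ e (h - (2 * r) • e) := by
        rw [inner_sub_right, real_inner_smul_right, real_inner_self_eq_norm_sq, he]
        ring
      have h2 := abs_real_inner_le_norm e (h - (2 * r) • e)
      rw [he, one_mul] at h2
      linarith [neg_abs_le (inner ℝ e (h - (2 * r) • e))]
    set w : Em m × Em k → ℝ≥0∞ := fun z => ENNReal.ofReal (‖z.1‖ ^ (2 * γ)) with hw
    have hwm : Measurable w := by fun_prop
    have T1 := lintegral_enorm_translate_cutoff_sub_sq_le volume hu hψ hψM ht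
      (w := fun _ => 1) measurable_const (h, 0) (fun _ _ => rfl) (g := fun z => ‖gradX u z‖ₑ)
      enorm_ne_top (fun z => enorm_fderiv_inl_le hu z h)
    have T2 := lintegral_enorm_translate_cutoff_sub_sq_le volume hu hψ hψM ht
      hwm (0, l) (fun z τ => by simp [hw]) (g := fun z => ‖gradY u z‖ₑ)
      enorm_ne_top (fun z => enorm_fderiv_inr_le hu z l)
    simp only [one_mul] at T1
    have hpt : ∀ z ∈ D, ‖v (z + (h, l)) - v z‖ₑ ^ 2 ≤ 2 * ‖v (z + (h, 0)) - v z‖ₑ ^ 2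
        + 2 * (ENNReal.ofReal (r ^ (-(2 * γ))) * (w (z + (h, 0)) *
          ‖v (z + (h, 0) + (0, l)) - v (z + (h, 0))‖ₑ ^ 2)) := by
      intro z hz
      have hx : r ≤ ‖z.1 + h‖ := by
        have h1 := (le_abs_self _).trans (abs_real_inner_le_norm e (z.1 + h))
        rw [he, one_mul, inner_add_right] at h1
        linarith [hz.2]
      have hw1 : 1 ≤ ENNReal.ofReal (r ^ (-(2 * γ))) * w (z + (h, 0)) := by
        rw [hw, ← ENNReal.ofReal_mul (by positivity), ENNReal.one_le_ofReal]
        calc (1:ℝ) = r ^ (-(2 * γ)) * r ^ (2 * γ) := by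
              rw [← Real.rpow_add hr]; simp
          _ ≤ _ := by
              gcongr
              exact hx
      have hsum : z + (h, l) = z + (h, 0) + (0, l) := by
        rw [add_assoc]; simp
      have hadd : ‖v (z + (h, l)) - v z‖ₑ ≤ ‖v (z + (h, 0)) - v z‖ₑ +
          ‖v (z + (h, 0) + (0, l)) - v (z + (h, 0))‖ₑ := by
        rw [hsum, add_comm]
        refine le_trans (le_of_eq ?_) (enorm_add_le _ _)
        congr 1
        ring
      have hsq := ENNReal.rpow_add_le_mul_rpow_add_rpow ‖v (z + (h, 0)) - v z‖ₑ
        ‖v (z + (h, 0) + (0, l)) - v (z + (h, 0))‖ₑ (one_le_two : (1:ℝ) ≤ 2)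
      norm_num at hsq
      calc _ ≤ _ := pow_le_pow_left' hadd 2
        _ ≤ _ := hsq
        _ ≤ _ := by
          rw [mul_add, ← mul_assoc (ENNReal.ofReal _)]
          gcongr
          exact le_mul_of_one_le_left' hw1
    have hm1 : Measurable fun z => 2 * ‖v (z + (h, 0)) - v z‖ₑ ^ 2 := by
      have : Continuous fun z => v (z + (h, 0)) - v z := by fun_prop
      exact (this.measurable.enorm.pow_const 2).const_mul 2
    calc ∫⁻ z in D, ‖v (z + (h, l)) - v z‖ₑ ^ 2
        ≤ ∫⁻ z in D, (2 * ‖v (z + (h, 0)) - v z‖ₑ ^ 2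
        + 2 * (ENNReal.ofReal (r ^ (-(2 * γ))) * (w (z + (h, 0)) *
          ‖v (z + (h, 0) + (0, l)) - v (z + (h, 0))‖ₑ ^ 2))) := setLIntegral_mono' hDm hpt
      _ ≤ ∫⁻ z, (2 * ‖v (z + (h, 0)) - v z‖ₑ ^ 2
        + 2 * (ENNReal.ofReal (r ^ (-(2 * γ))) * (w (z + (h, 0)) *
          ‖v (z + (h, 0) + (0, l)) - v (z + (h, 0))‖ₑ ^ 2))) := setLIntegral_le_lintegral _ _
      _ = 2 * (∫⁻ z, ‖v (z + (h, 0)) - v z‖ₑ ^ 2) + 2 * (ENNReal.ofReal (r ^ (-(2 * γ))) *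
            ∫⁻ z, w z * ‖v (z + (0, l)) - v z‖ₑ ^ 2) := by
          rw [lintegral_add_left hm1, lintegral_const_mul' _ _ (by simp),
            lintegral_const_mul' _ _ (by simp), lintegral_const_mul' _ _ ENNReal.ofReal_ne_top,
            lintegral_add_right_eq_self (fun z => w z * ‖v (z + (0, l)) - v z‖ₑ ^ 2) (h, 0)]
      _ ≤ 2 * (ENNReal.ofReal ((3 * r * (M / t)) ^ 2) * ∫⁻ z in A, ‖gradX u z‖ₑ ^ 2) +
            2 * (ENNReal.ofReal (r ^ (-(2 * γ))) * (ENNReal.ofReal ((r ^ (γ + 1) * (M / t)) ^ 2) *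
            ∫⁻ z in A, w z * ‖gradY u z‖ₑ ^ 2)) := by
          gcongr 2 * ?_ + 2 * (_ * ?_)
          · refine T1.trans ?_
            gcongr
            rw [← ofReal_norm, ← ENNReal.ofReal_mul (norm_nonneg _),
              ← ENNReal.ofReal_pow (by positivity)]
            gcongr
          · refine T2.trans ?_
            gcongr
            rw [← ofReal_norm, ← ENNReal.ofReal_mul (norm_nonneg _),
              ← ENNReal.ofReal_pow (by positivity)]
            gcongr
      _ ≤ ENNReal.ofReal (18 * r ^ 2 * (M / t) ^ 2) * (∫⁻ z in A, ‖gradX u z‖ₑ ^ 2) +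
            ENNReal.ofReal (18 * r ^ 2 * (M / t) ^ 2) *
            ∫⁻ z in A, w z * ‖gradY u z‖ₑ ^ 2 := by
          have hrr : r ^ (-(2 * γ)) * (r ^ (γ + 1)) ^ 2 = r ^ 2 := by
            rw [← Real.rpow_natCast (r ^ (γ + 1)), ← Real.rpow_mul hr.le, ← Real.rpow_add hr,
              ← Real.rpow_natCast]
            congr 1
            push_cast
            ring
          rw [← mul_assoc 2, ← mul_assoc (ENNReal.ofReal (r ^ (-(2 * γ)))),
            ← ENNReal.ofReal_mul (by positivity), ← mul_assoc 2, two_mul_ofReal, two_mul_ofReal]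
          refine add_le_add (mul_le_mul' (ENNReal.ofReal_le_ofReal ?_) le_rfl)
            (mul_le_mul' (ENNReal.ofReal_le_ofReal ?_) le_rfl)
          · apply le_of_eq
            ring
          · calc 2 * (r ^ (-(2 * γ)) * (r ^ (γ + 1) * (M / t)) ^ 2)
                = 2 * (r ^ (-(2 * γ)) * (r ^ (γ + 1)) ^ 2) * (M / t) ^ 2 := by ring
              _ ≤ _ := by
                rw [hrr]
                gcongr
                norm_num
      _ ≤ _ := by
          rw [← mul_add]
          gcongr
          refine (le_lintegral_add _ _).trans (lintegral_mono fun z => ?_)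
          rw [grushinSq, ENNReal.ofReal_add (by positivity) (by positivity),
            ENNReal.ofReal_mul (by positivity), ENNReal.ofReal_pow (norm_nonneg _),
            ENNReal.ofReal_pow (norm_nonneg _), ofReal_norm, ofReal_norm]
  have hfin : volume K * volume D
      ≤ volume K * (ENNReal.ofReal (36 * r ^ 2 * (M / t) ^ 2) * G) := by
    calc volume K * volume D = ∫⁻ z in D, volume K := by simp
      _ ≤ ∫⁻ z in D, 2 * ∫⁻ d in K, ‖v (z + d) - v z‖ₑ ^ 2 := setLIntegral_mono' hDm hlow
      _ = 2 * ∫⁻ z in D, (∫⁻ d in K, ‖v (z + d) - v z‖ₑ ^ 2) :=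
          lintegral_const_mul' _ _ (by simp)
      _ = 2 * ∫⁻ d in K, (∫⁻ z in D, ‖v (z + d) - v z‖ₑ ^ 2) := by
          rw [lintegral_lintegral_swap]
          have : Continuous fun p : (Em m × Em k) × (Em m × Em k) => v (p.1 + p.2) - v p.1 := by
            fun_prop
          exact (this.measurable.enorm.pow_const 2).aemeasurable
      _ ≤ 2 * ∫⁻ d in K, ENNReal.ofReal (18 * r ^ 2 * (M / t) ^ 2) * G := by
          gcongr 2 * ?_
          exact setLIntegral_mono' hKm hup
      _ = volume K * (2 * ENNReal.ofReal (18 * r ^ 2 * (M / t) ^ 2) * G) := by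
          rw [setLIntegral_const]; ring
      _ = _ := by
          rw [two_mul_ofReal]
          ring_nf
  exact (ENNReal.mul_le_mul_iff_right hKpos hKtop).1 hfin

/-- Weak-type form of the Grushin–Sobolev inequality, localized to the energy between the levels
`t` and `2 t`. -/
theorem exists_volume_level_le {m k : ℕ} (hm : 1 ≤ m) {γ : ℝ} (hγ : 0 ≤ γ)
    (hN : 2 < (m : ℝ) + (γ + 1) * k) : ∃ C : ℝ, 0 < C ∧ ∀ u : Em m × Em k → ℝ, ContDiff ℝ 1 u →
      ∫⁻ z, ‖u z‖ₑ ^ twoStar m k γ ≠ ∞ → ∀ t : ℝ, 0 < t →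
      ENNReal.ofReal (t ^ twoStar m k γ) * volume {z | 2 * t < |u z|}
        ≤ ENNReal.ofReal C * (∫⁻ z, ‖u z‖ₑ ^ twoStar m k γ) ^ (1 - 2 / twoStar m k γ) *
          ∫⁻ z in {z | t < |u z| ∧ |u z| < 2 * t}, ENNReal.ofReal (grushinSq γ u z) := by
  obtain ⟨ψ, M, hM, hψ, hψ0, hψ1, hψM⟩ := exists_contDiff_level_cutoff
  set d : ℝ := (m : ℝ) + (γ + 1) * k with hd
  set q : ℝ := twoStar m k γ with hq
  have hqd : q = 2 * d / (d - 2) := rfl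
  have hd2 : 0 < d - 2 := by linarith
  have hq0 : 0 < q := by rw [hqd]; positivity
  have hexp : 1 - 2 / q = 2 / d := by
    rw [hqd]; field_simp; ring
  have hexp2 : q - 2 - q * (2 / d) = 0 := by
    rw [hqd]; field_simp; ring
  set b₁ := volume (Metric.ball (0 : Em m) 1) with hb₁
  set b₂ := volume (Metric.ball (0 : Em k) 1) with hb₂
  have hω0 : b₁ * b₂ ≠ 0 := mul_ne_zero (Metric.measure_ball_pos _ _ one_pos).ne'
    (Metric.measure_ball_pos _ _ one_pos).ne'
  have hωt : b₁ * b₂ ≠ ∞ := ENNReal.mul_ne_top measure_ball_lt_top.ne measure_ball_lt_top.ne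
  set ω := (b₁ * b₂).toReal with hω
  have hωpos : 0 < ω := ENNReal.toReal_pos hω0 hωt
  refine ⟨72 * M ^ 2 * (2 / ω) ^ (2 / d), by positivity, fun u hu hF t ht => ?_⟩
  set F := ∫⁻ z, ‖u z‖ₑ ^ q with hFdef
  have hcheb : ENNReal.ofReal (t ^ q) * volume {z | t < |u z|} ≤ F := by
    have hm := mul_meas_ge_le_lintegral (μ := (volume : Measure (Em m × Em k)))
      (f := fun z => ‖u z‖ₑ ^ q) (hu.continuous.measurable.enorm.pow_const q)
      (ENNReal.ofReal (t ^ q))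
    refine le_trans ?_ hm
    refine mul_le_mul' le_rfl (measure_mono fun z hz => ?_)
    change ENNReal.ofReal (t ^ q) ≤ ‖u z‖ₑ ^ q
    rw [← ENNReal.ofReal_rpow_of_pos ht, ← ofReal_norm]
    gcongr
    exact (show t < |u z| from hz).le
  have htq : 0 < t ^ q := by positivity
  rcases eq_or_ne F 0 with hF0 | hF0
  · have h1 : ENNReal.ofReal (t ^ q) * volume {z | 2 * t < |u z|} ≤ 0 := by
      rw [← hF0]
      refine le_trans ?_ hcheb
      gcongr
      linarith
    exact h1.trans zero_le
  have hFp : 0 < F.toReal := ENNReal.toReal_pos hF0 hF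
  set a : ℝ := 2 * F.toReal / (t ^ q * ω) with ha
  have hapos : 0 < a := by positivity
  set r : ℝ := a ^ (1 / d) with hr
  have hrpos : 0 < r := by positivity
  have hrd : r ^ d = a := by
    rw [hr, ← Real.rpow_mul hapos.le]
    field_simp
    simp
  have hr2 : r ^ 2 = a ^ (2 / d) := by
    rw [hr, ← Real.rpow_natCast, ← Real.rpow_mul hapos.le]
    congr 1
    push_cast
    ring
  have hbox : ∀ e : Em m, 2 * volume {z | t < |u z|}
      ≤ volume (Metric.ball ((2 * r) • e) r ×ˢ Metric.ball (0 : Em k) (r ^ (γ + 1))) := by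
    intro e
    have hpow : r ^ d = r ^ m * (r ^ (γ + 1)) ^ k := by
      rw [hd, Real.rpow_add hrpos, Real.rpow_mul hrpos.le, Real.rpow_natCast, Real.rpow_natCast]
    have hv : volume (Metric.ball ((2 * r) • e) r ×ˢ Metric.ball (0 : Em k) (r ^ (γ + 1)))
        = ENNReal.ofReal (a * ω) := by
      have hρ : 0 < r ^ (γ + 1) := by positivity
      rw [Measure.volume_eq_prod, Measure.prod_prod, Measure.addHaar_ball_of_pos _ _ hrpos,
        Measure.addHaar_ball_of_pos _ _ hρ, ← hrd, ENNReal.ofReal_mul (by positivity),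
        hω, ENNReal.ofReal_toReal hωt, hpow, ENNReal.ofReal_mul (by positivity)]
      simp only [finrank_euclideanSpace, Fintype.card_fin]
      ring
    rw [hv, ha, show 2 * F.toReal / (t ^ q * ω) * ω = 2 * F.toReal / t ^ q by field_simp,
      ENNReal.ofReal_div_of_pos htq, ENNReal.ofReal_mul (by norm_num), ENNReal.ofReal_toReal hF,
      ENNReal.ofReal_ofNat, mul_div_assoc]
    gcongr
    rw [ENNReal.le_div_iff_mul_le (by simp [htq]) (by simp), mul_comm]
    exact hcheb
  set G := ∫⁻ z in {z | t < |u z| ∧ |u z| < 2 * t}, ENNReal.ofReal (grushinSq γ u z) with hG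
  set e : Em m := EuclideanSpace.single ⟨0, hm⟩ 1 with he
  have hen : ‖e‖ = 1 := by simp [he]
  have h1 := volume_halfspace_level_le hγ hu hM hψ hψ0 hψ1 hψM ht hrpos hen (hbox e)
  have h2 := volume_halfspace_level_le hγ hu hM hψ hψ0 hψ1 hψM ht hrpos
    (by rwa [norm_neg] : ‖-e‖ = 1) (hbox (-e))
  have h3 : volume {z | 2 * t < |u z|} ≤ ENNReal.ofReal (72 * r ^ 2 * (M / t) ^ 2) * G := by
    calc volume {z | 2 * t < |u z|}
        ≤ volume ({z : Em m × Em k | 2 * t < |u z| ∧ 0 ≤ inner ℝ e z.1} ∪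
          {z : Em m × Em k | 2 * t < |u z| ∧ 0 ≤ inner ℝ (-e) z.1}) := by
          refine measure_mono fun z hz => ?_
          rcases le_total 0 (inner ℝ e z.1 : ℝ) with h | h
          · exact Or.inl ⟨hz, h⟩
          · exact Or.inr ⟨hz, by rw [inner_neg_left]; linarith⟩
      _ ≤ _ := measure_union_le _ _
      _ ≤ _ := add_le_add h1 h2
      _ = _ := by
          rw [← add_mul, ← ENNReal.ofReal_add (by positivity) (by positivity)]
          congr 2
          ring
  calc ENNReal.ofReal (t ^ q) * volume {z | 2 * t < |u z|}
      ≤ ENNReal.ofReal (t ^ q) * (ENNReal.ofReal (72 * r ^ 2 * (M / t) ^ 2) * G) := by gcongr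
    _ = _ := by
      rw [hexp, ← ENNReal.ofReal_toReal hF, ENNReal.ofReal_rpow_of_pos hFp, ← mul_assoc,
        ← ENNReal.ofReal_mul (by positivity), ← ENNReal.ofReal_mul (by positivity)]
      congr 2
      rw [hr2, ha, show 2 * F.toReal / (t ^ q * ω) = 2 / ω * F.toReal * t ^ (-q) by
        rw [Real.rpow_neg ht.le]; field_simp, Real.mul_rpow (by positivity) (by positivity),
        Real.mul_rpow (by positivity) (by positivity), ← Real.rpow_mul ht.le]
      have : t ^ q * t ^ (-q * (2 / d)) * t⁻¹ ^ 2 = 1 := by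
        rw [inv_pow, ← Real.rpow_natCast, ← Real.rpow_neg ht.le, ← Real.rpow_add ht,
          ← Real.rpow_add ht]
        convert Real.rpow_zero t using 2
        push_cast
        linarith
      calc _ = 72 * M ^ 2 * (2 / ω) ^ (2 / d) * F.toReal ^ (2 / d) *
            (t ^ q * t ^ (-q * (2 / d)) * t⁻¹ ^ 2) := by ring
        _ = _ := by rw [this, mul_one]

/-- The Grushin–Sobolev inequality at the critical exponent. -/
theorem exists_grushin_sobolev {m k : ℕ} (hm : 1 ≤ m) {γ : ℝ} (hγ : 0 ≤ γ)
    (hN : 2 < (m : ℝ) + (γ + 1) * k) : ∃ C : ℝ, 0 < C ∧ ∀ u : Em m × Em k → ℝ, ContDiff ℝ 1 u →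
      HasCompactSupport u → ∫⁻ z, ‖u z‖ₑ ^ twoStar m k γ
        ≤ ENNReal.ofReal C * (∫⁻ z, ENNReal.ofReal (grushinSq γ u z)) ^ (twoStar m k γ / 2) := by
  obtain ⟨C, hC, hlevel⟩ := exists_volume_level_le (m := m) (k := k) hm hγ hN
  set q : ℝ := twoStar m k γ with hq
  have hq0 : 0 < q := by
    have : 0 < (m : ℝ) + (γ + 1) * k - 2 := by linarith
    rw [hq, twoStar]; positivity
  refine ⟨(4 ^ q * C) ^ (q / 2), by positivity, fun u hu hc => ?_⟩
  set F := ∫⁻ z, ‖u z‖ₑ ^ q with hFdef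
  set G := ∫⁻ z, ENNReal.ofReal (grushinSq γ u z) with hG
  have hF : F ≠ ∞ := by
    have h1 := (hu.continuous.memLp_of_hasCompactSupport (p := ENNReal.ofReal q)
      (μ := volume) hc).eLpNorm_lt_top
    have h2 := lintegral_rpow_enorm_lt_top_of_eLpNorm_lt_top (by simpa using hq0)
      ENNReal.ofReal_ne_top h1
    rw [ENNReal.toReal_ofReal hq0.le] at h2
    exact h2.ne
  set T : ℤ → Set (Em m × Em k) := fun j => {z | 2 * (2:ℝ) ^ j < |u z|} with hT
  set A : ℤ → Set (Em m × Em k) := fun j => {z | (2:ℝ) ^ j < |u z| ∧ |u z| < 2 * (2:ℝ) ^ j}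
    with hA
  have hTm : ∀ j, MeasurableSet (T j) := fun j =>
    (isOpen_lt continuous_const hu.continuous.abs).measurableSet
  have hAm : ∀ j, MeasurableSet (A j) := fun j =>
    ((isOpen_lt continuous_const hu.continuous.abs).inter
      (isOpen_lt hu.continuous.abs continuous_const)).measurableSet
  have hAd : Pairwise (Function.onFun Disjoint A) := by
    have key : ∀ i j : ℤ, i < j → Disjoint (A i) (A j) := by
      intro i j hij
      refine Set.disjoint_left.2 fun z hi hj => ?_
      have h1 : (2:ℝ) ^ (i + 1) ≤ 2 ^ j := zpow_le_zpow_right₀ one_le_two (by lia)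
      rw [zpow_add_one₀ two_ne_zero] at h1
      linarith [hi.2, hj.1]
    intro i j hij
    rcases lt_or_gt_of_ne hij with h | h
    · exact key i j h
    · exact (key j i h).symm
  have hpt : ∀ z, ‖u z‖ₑ ^ q ≤ ∑' j : ℤ, (T j).indicator
      (fun _ => ENNReal.ofReal (4 ^ q) * ENNReal.ofReal (((2:ℝ) ^ j) ^ q)) z := by
    intro z
    rcases eq_or_ne (u z) 0 with h0 | h0
    · simp [h0, hq0]
    · obtain ⟨n, hn1, hn2⟩ := exists_mem_Ioc_zpow (abs_pos.2 h0) (one_lt_two (α := ℝ))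
      refine le_trans ?_ (ENNReal.le_tsum (n - 1))
      have hz : z ∈ T (n - 1) := by
        change 2 * (2:ℝ) ^ (n - 1) < |u z|
        rw [zpow_sub_one₀ two_ne_zero]
        linarith
      rw [Set.indicator_of_mem hz, ← ENNReal.ofReal_mul (by positivity),
        ← Real.mul_rpow (by positivity) (by positivity), ← ENNReal.ofReal_rpow_of_pos (by positivity),
        ← ofReal_norm]
      gcongr
      rw [zpow_sub_one₀ two_ne_zero]
      rw [zpow_add_one₀ two_ne_zero] at hn2
      rw [Real.norm_eq_abs]
      linarith
  have hmain : F ≤ ENNReal.ofReal (4 ^ q * C) * F ^ (1 - 2 / q) * G := by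
    calc F ≤ ∫⁻ z, ∑' j : ℤ, (T j).indicator
          (fun _ => ENNReal.ofReal (4 ^ q) * ENNReal.ofReal (((2:ℝ) ^ j) ^ q)) z :=
          lintegral_mono hpt
      _ = ∑' j : ℤ, ENNReal.ofReal (4 ^ q) *
            (ENNReal.ofReal (((2:ℝ) ^ j) ^ q) * volume (T j)) := by
          rw [lintegral_tsum fun j => (measurable_const.indicator (hTm j)).aemeasurable]
          refine tsum_congr fun j => ?_
          rw [lintegral_indicator_const (hTm j), mul_assoc]
      _ ≤ ∑' j : ℤ, ENNReal.ofReal (4 ^ q) * (ENNReal.ofReal C * F ^ (1 - 2 / q) *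
            ∫⁻ z in A j, ENNReal.ofReal (grushinSq γ u z)) := by
          refine ENNReal.tsum_le_tsum fun j => ?_
          gcongr _ * ?_
          exact hlevel u hu hF _ (by positivity)
      _ = ENNReal.ofReal (4 ^ q * C) * F ^ (1 - 2 / q) *
            ∫⁻ z in ⋃ j, A j, ENNReal.ofReal (grushinSq γ u z) := by
          rw [ENNReal.tsum_mul_left, ENNReal.tsum_mul_left, lintegral_iUnion hAm hAd,
            ENNReal.ofReal_mul (by positivity)]
          ring
      _ ≤ _ := by
          gcongr
          exact setLIntegral_le_lintegral _ _
  rcases eq_or_ne F 0 with hF0 | hF0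
  · rw [hF0]; exact zero_le
  have hcancel : F ^ (2 / q) ≤ ENNReal.ofReal (4 ^ q * C) * G := by
    have h1 : F ^ (1 - 2 / q) * F ^ (2 / q) = F := by
      rw [← ENNReal.rpow_add _ _ hF0 hF]; simp
    have h2 : F ^ (1 - 2 / q) * F ^ (2 / q)
        ≤ F ^ (1 - 2 / q) * (ENNReal.ofReal (4 ^ q * C) * G) := by
      rw [h1]
      calc F ≤ _ := hmain
        _ = _ := by ring
    exact (ENNReal.mul_le_mul_iff_right (ENNReal.rpow_pos (pos_iff_ne_zero.2 hF0) hF).ne'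
      (ENNReal.rpow_ne_top_of_ne_zero hF0 hF)).1 h2
  calc F = (F ^ (2 / q)) ^ (q / 2) := by
        rw [← ENNReal.rpow_mul]
        field_simp
        simp
    _ ≤ (ENNReal.ofReal (4 ^ q * C) * G) ^ (q / 2) := by gcongr
    _ = _ := by
        rw [ENNReal.mul_rpow_of_nonneg _ _ (by positivity),
          ENNReal.ofReal_rpow_of_pos (by positivity)]

theorem rpow_le_interpolate {s E p q : ℝ} (hs : 0 ≤ s) (hE : 0 < E) (hp : 2 ≤ p) (hpq : p ≤ q) :
    s ^ p ≤ E ^ (p - 2) * s ^ 2 + E ^ (p - q) * s ^ q := by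
  rcases hs.eq_or_lt with rfl | hs'
  · rw [Real.zero_rpow (by linarith)]
    positivity
  rcases le_total s E with h | h
  · have h1 : s ^ p = s ^ (p - 2) * s ^ 2 := by
      rw [← Real.rpow_natCast s 2, ← Real.rpow_add hs']
      congr 1
      push_cast
      ring
    have h2 : s ^ (p - 2) ≤ E ^ (p - 2) := Real.rpow_le_rpow hs h (by linarith)
    have h3 : 0 ≤ E ^ (p - q) * s ^ q := by positivity
    rw [h1]
    nlinarith [mul_le_mul_of_nonneg_right h2 (sq_nonneg s)]
  · have h1 : s ^ p = s ^ (p - q) * s ^ q := by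
      rw [← Real.rpow_add hs']
      congr 1
      ring
    have h2 : s ^ (p - q) ≤ E ^ (p - q) :=
      Real.rpow_le_rpow_of_nonpos hE h (by linarith)
    have h3 : 0 ≤ E ^ (p - 2) * s ^ 2 := by positivity
    rw [h1]
    nlinarith [mul_le_mul_of_nonneg_right h2 (Real.rpow_nonneg hs q)]

theorem grushinSq_nonneg {m k : ℕ} (γ : ℝ) (u : Em m × Em k → ℝ) (z : Em m × Em k) :
    0 ≤ grushinSq γ u z := by
  rw [grushinSq]
  positivity

/-- Weighted Sobolev embedding, case (i): under (V), (Q) with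
`α ≤ N < β` and `2 ≤ p ≤ 2*_γ`, there is `C > 0` with
`(∫ Q|u|^p)^{1/p} ≤ C ‖u‖_{E_V^γ}` for all `u ∈ C_c^∞(ℝ^N)`. -/
theorem weighted_embedding_case_i (m k : ℕ) (hm : 1 ≤ m) (hk : 1 ≤ k) (hN : 3 ≤ m + k)
    (γ : ℝ) (hγ : 0 < γ)
    (V Q : Em m × Em k → ℝ) (hVmeas : Measurable V) (hQmeas : Measurable Q)
    (C_V C_Q α β : ℝ) (hCV : 0 < C_V) (hCQ : 0 < C_Q)
    (hV : ∀ᵐ z ∂(volume : Measure (Em m × Em k)), C_V / (1 + pnorm z) ^ α ≤ V z)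
    (hQ : ∀ᵐ z ∂(volume : Measure (Em m × Em k)), 0 < Q z ∧ Q z ≤ C_Q / (1 + pnorm z) ^ β)
    (hα : α ≤ ((m : ℝ) + k)) (hβ : ((m : ℝ) + k) < β)
    (p : ℝ) (hp1 : 2 ≤ p) (hp2 : p ≤ twoStar m k γ) :
    ∃ C : ℝ, 0 < C ∧ ∀ u : Em m × Em k → ℝ, ContDiff ℝ (⊤ : ℕ∞) u → HasCompactSupport u →
      (∫⁻ z, ENNReal.ofReal (Q z * |u z| ^ p)) ^ (1 / p)
        ≤ ENNReal.ofReal C *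
          (∫⁻ z, ENNReal.ofReal (grushinSq γ u z + V z * u z ^ 2)) ^ ((1:ℝ) / 2) := by
  have hm' : (1 : ℝ) ≤ m := by exact_mod_cast hm
  have hk' : (1 : ℝ) ≤ k := by exact_mod_cast hk
  have hN' : (3 : ℝ) ≤ m + k := by exact_mod_cast hN
  obtain ⟨C, hC, hsob⟩ := exists_grushin_sobolev (m := m) (k := k) hm hγ.le (by nlinarith)
  set q := twoStar m k γ with hq
  have hβ0 : 0 < β := by linarith
  set K : ℝ := C_Q / C_V + C_Q * C with hK
  have hK0 : 0 < K := by positivity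
  refine ⟨K ^ (1 / p), by positivity, fun u hu hc => ?_⟩
  set S := ∫⁻ z, ENNReal.ofReal (grushinSq γ u z + V z * u z ^ 2) with hS
  have hV0 : ∀ᵐ z ∂(volume : Measure (Em m × Em k)), 0 ≤ V z := by
    filter_upwards [hV] with z hz
    have : 0 ≤ pnorm z := Real.sqrt_nonneg _
    exact le_trans (by positivity) hz
  have hQV : ∀ᵐ z ∂(volume : Measure (Em m × Em k)), 0 ≤ Q z ∧ Q z ≤ C_Q ∧
      Q z ≤ C_Q / C_V * V z := by
    filter_upwards [hV, hQ] with z hz hz'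
    have h0 : 1 ≤ 1 + pnorm z := by
      have : 0 ≤ pnorm z := Real.sqrt_nonneg _
      linarith
    have hpos : 0 < 1 + pnorm z := by linarith
    refine ⟨hz'.1.le, hz'.2.trans (div_le_self hCQ.le (Real.one_le_rpow h0 hβ0.le)),
      hz'.2.trans ?_⟩
    calc C_Q / (1 + pnorm z) ^ β ≤ C_Q / (1 + pnorm z) ^ α := by
          gcongr
          linarith
      _ = C_Q / C_V * (C_V / (1 + pnorm z) ^ α) := by field_simp
      _ ≤ _ := by gcongr
  have hsob' : ∫⁻ z, ‖u z‖ₑ ^ q ≤ ENNReal.ofReal C * S ^ (q / 2) := by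
    refine (hsob u (hu.of_le (by exact_mod_cast le_top)) hc).trans ?_
    have hq0 : 0 ≤ q / 2 := by linarith
    gcongr ENNReal.ofReal C * ?_ ^ (q / 2)
    refine lintegral_mono_ae ?_
    filter_upwards [hV0] with z hz
    exact ENNReal.ofReal_le_ofReal (le_add_of_nonneg_right (by positivity))
  have hp0 : 0 < p := by linarith
  rcases eq_or_ne S ∞ with hStop | hStop
  · rw [hStop, ENNReal.top_rpow_of_pos (by norm_num), ENNReal.mul_top]
    · exact le_top
    · simpa using Real.rpow_pos_of_pos hK0 _
  rcases eq_or_ne S 0 with hS0 | hS0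
  · rw [hS0, ENNReal.zero_rpow_of_pos (by linarith), mul_zero] at hsob'
    have h0 := (lintegral_eq_zero_iff (hu.continuous.measurable.enorm.pow_const q)).1
      (le_antisymm hsob' zero_le)
    have hz : ∫⁻ z, ENNReal.ofReal (Q z * |u z| ^ p) = 0 := by
      rw [← lintegral_zero (μ := (volume : Measure (Em m × Em k)))]
      refine lintegral_congr_ae ?_
      filter_upwards [h0] with z hz
      have hz' : u z = 0 := by
        have := (ENNReal.rpow_eq_zero_iff_of_pos (by linarith)).1 hz
        simpa using this
      simp [hz', Real.zero_rpow hp0.ne']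
    rw [hz, ENNReal.zero_rpow_of_pos (by positivity)]
    exact zero_le
  have hSpos : 0 < S.toReal := ENNReal.toReal_pos hS0 hStop
  set E := S.toReal ^ ((1 : ℝ) / 2) with hE
  have hE0 : 0 < E := by positivity
  have hSrpow : ∀ s : ℝ, 0 ≤ s → S ^ (s / 2) = ENNReal.ofReal (E ^ s) := fun s hs => by
    rw [hE, ← Real.rpow_mul hSpos.le, one_div_mul_eq_div,
      ← ENNReal.ofReal_rpow_of_nonneg hSpos.le (by positivity), ENNReal.ofReal_toReal hStop]
  have hS2 : S = ENNReal.ofReal (E ^ (2 : ℝ)) := by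
    rw [← hSrpow 2 (by norm_num)]
    simp
  have hmain : ∫⁻ z, ENNReal.ofReal (Q z * |u z| ^ p) ≤ ENNReal.ofReal (K * E ^ p) := by
    calc ∫⁻ z, ENNReal.ofReal (Q z * |u z| ^ p)
        ≤ ∫⁻ z, (ENNReal.ofReal (E ^ (p - 2) * (C_Q / C_V)) *
              ENNReal.ofReal (grushinSq γ u z + V z * u z ^ 2) +
            ENNReal.ofReal (E ^ (p - q) * C_Q) * ‖u z‖ₑ ^ q) := by
          refine lintegral_mono_ae ?_
          filter_upwards [hV0, hQV] with z hVz hQz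
          obtain ⟨h0, h1, h2⟩ := hQz
          have hG := grushinSq_nonneg γ u z
          rw [Real.enorm_eq_ofReal_abs, ENNReal.ofReal_rpow_of_nonneg (abs_nonneg _) (by linarith),
            ← ENNReal.ofReal_mul (by positivity), ← ENNReal.ofReal_mul (by positivity),
            ← ENNReal.ofReal_add (by positivity) (by positivity)]
          refine ENNReal.ofReal_le_ofReal ?_
          calc Q z * |u z| ^ p
              ≤ Q z * (E ^ (p - 2) * |u z| ^ 2 + E ^ (p - q) * |u z| ^ q) := by
                gcongr
                exact rpow_le_interpolate (abs_nonneg _) hE0 hp1 hp2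
            _ = E ^ (p - 2) * (Q z * u z ^ 2) + E ^ (p - q) * Q z * |u z| ^ q := by
                rw [sq_abs]
                ring
            _ ≤ E ^ (p - 2) * (C_Q / C_V * V z * u z ^ 2) + E ^ (p - q) * C_Q * |u z| ^ q := by
                gcongr
            _ ≤ _ := by
                have : 0 ≤ E ^ (p - 2) * (C_Q / C_V) * grushinSq γ u z := by positivity
                linarith
      _ = ENNReal.ofReal (E ^ (p - 2) * (C_Q / C_V)) * S +
            ENNReal.ofReal (E ^ (p - q) * C_Q) * ∫⁻ z, ‖u z‖ₑ ^ q := by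
          rw [lintegral_add_right _
            ((hu.continuous.measurable.enorm.pow_const q).const_mul _),
            lintegral_const_mul' _ _ (by simp), lintegral_const_mul' _ _ (by simp)]
      _ ≤ ENNReal.ofReal (E ^ (p - 2) * (C_Q / C_V)) * S +
            ENNReal.ofReal (E ^ (p - q) * C_Q) * (ENNReal.ofReal C * S ^ (q / 2)) := by
          gcongr
      _ = ENNReal.ofReal (K * E ^ p) := by
          rw [hSrpow q (by linarith), hS2, ← ENNReal.ofReal_mul (by positivity),
            ← ENNReal.ofReal_mul (by positivity), ← ENNReal.ofReal_mul (by positivity),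
            ← ENNReal.ofReal_add (by positivity) (by positivity)]
          congr 1
          have e1 : E ^ (p - 2) * E ^ (2 : ℝ) = E ^ p := by
            rw [← Real.rpow_add hE0, sub_add_cancel]
          have e2 : E ^ (p - q) * E ^ q = E ^ p := by
            rw [← Real.rpow_add hE0, sub_add_cancel]
          linear_combination C_Q / C_V * e1 + C_Q * C * e2
  calc _ ≤ ENNReal.ofReal (K * E ^ p) ^ (1 / p) := by gcongr
    _ = ENNReal.ofReal (K ^ (1 / p)) * ENNReal.ofReal (E ^ (1 : ℝ)) := by
        rw [ENNReal.ofReal_rpow_of_nonneg (by positivity) (by positivity),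
          Real.mul_rpow hK0.le (by positivity), ← Real.rpow_mul hE0.le,
          mul_one_div_cancel hp0.ne', ENNReal.ofReal_mul (by positivity)]
    _ = _ := by rw [← hSrpow 1 zero_le_one]
end
end

section
/- Assume conditions (V) and (Q) with α ≤ N and β_ ≤ β < N, where β_ := max{ N − 2*_γ(N−2)/2, N − 2*_γ(N−α)/2 }, and let p_ ≤ p ≤ 2*_γ, where p_ := max{ 2, 2(N−β)/(N−2), 2(N−β)/(N−α) }. Then there exists a constant C > 0 such that for every u ∈ C_c^∞(ℝ^N), (∫_{ℝ^N} Q(z)|u|^p dz)^{1/p} ≤ C ‖u‖_{E_V^γ}; that is, the embedding E_V^γ ↪ L^p_Q(ℝ^N) is continuous. -/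
open MeasureTheory Filter

noncomputable section

theorem lintegral_translate_sub_sq_le {E : Type*} [NormedAddCommGroup E] [NormedSpace ℝ E]
    [MeasurableSpace E] [BorelSpace E] [SecondCountableTopology E] (μ : Measure E) [SFinite μ]
    [μ.IsAddRightInvariant] {f : E → ℝ} (hf : ContDiff ℝ 1 f) (v : E) {S : Set E}
    (hSm : MeasurableSet S) (hS : ∀ (s : ℝ) (z : E), z + s • v ∈ S ↔ z ∈ S) :
    ∫⁻ z in S, ENNReal.ofReal ((f (z + v) - f z) ^ 2) ∂μ
      ≤ ∫⁻ z in S, ENNReal.ofReal ((fderiv ℝ f z v) ^ 2) ∂μ := by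
  have hcont : Continuous fun z => fderiv ℝ f z v :=
    (hf.continuous_fderiv (by norm_num)).clm_apply continuous_const
  have hpt : ∀ z, ENNReal.ofReal ((f (z + v) - f z) ^ 2)
      ≤ ∫⁻ s in Set.Ioc (0 : ℝ) 1, ENNReal.ofReal ((fderiv ℝ f (z + s • v) v) ^ 2) := by
    intro z
    set g : ℝ → ℝ := fun s => fderiv ℝ f (z + s • v) v with hg
    have hgc : Continuous g := hcont.comp (by fun_prop)
    have hd : ∀ s, HasDerivAt (fun s : ℝ => f (z + s • v)) (g s) s := by
      intro s
      have h1 : HasDerivAt (fun s : ℝ => z + s • v) v s := by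
        simpa using ((hasDerivAt_id s).smul_const v).const_add z
      exact ((hf.differentiable (by norm_num)) (z + s • v)).hasFDerivAt.comp_hasDerivAt s h1
    have hI : ∫ s in (0 : ℝ)..1, g s = f (z + v) - f z := by
      have := intervalIntegral.integral_eq_sub_of_hasDerivAt (fun s _ => hd s)
        (hgc.intervalIntegrable 0 1)
      simpa using this
    have hJ : (f (z + v) - f z) ^ 2 ≤ ∫ s in (0 : ℝ)..1, g s ^ 2 := by
      rw [← hI]
      set c := ∫ s in (0 : ℝ)..1, g s
      have h0 : 0 ≤ ∫ s in (0 : ℝ)..1, (g s - c) ^ 2 :=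
        intervalIntegral.integral_nonneg (by norm_num) fun _ _ => sq_nonneg _
      have h1 : ∫ s in (0 : ℝ)..1, (g s - c) ^ 2
          = (∫ s in (0 : ℝ)..1, g s ^ 2) - 2 * c * c + c ^ 2 := by
        have : ∀ s, (g s - c) ^ 2 = (g s ^ 2 - 2 * c * g s) + c ^ 2 := fun s => by ring
        simp_rw [this]
        rw [intervalIntegral.integral_add, intervalIntegral.integral_sub,
          intervalIntegral.integral_const_mul]
        · simp [c]
        all_goals exact Continuous.intervalIntegrable (by fun_prop) _ _
      nlinarith
    rw [intervalIntegral.integral_of_le (by norm_num)] at hJ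
    refine (ENNReal.ofReal_le_ofReal hJ).trans (le_of_eq ?_)
    rw [ofReal_integral_eq_lintegral_ofReal]
    · exact ((hgc.pow 2).integrableOn_Icc (a := 0) (b := 1)).mono_set Set.Ioc_subset_Icc_self
    · exact Eventually.of_forall fun _ => sq_nonneg _
  calc ∫⁻ z in S, ENNReal.ofReal ((f (z + v) - f z) ^ 2) ∂μ
      ≤ ∫⁻ z in S, (∫⁻ s in Set.Ioc (0 : ℝ) 1,
          ENNReal.ofReal ((fderiv ℝ f (z + s • v) v) ^ 2)) ∂μ := lintegral_mono fun z => hpt z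
    _ = ∫⁻ s in Set.Ioc (0 : ℝ) 1, ∫⁻ z in S,
          ENNReal.ofReal ((fderiv ℝ f (z + s • v) v) ^ 2) ∂μ := by
        refine lintegral_lintegral_swap (Measurable.aemeasurable ?_)
        have : Continuous fun q : E × ℝ => fderiv ℝ f (q.1 + q.2 • v) v :=
          hcont.comp (by fun_prop)
        exact (this.pow 2).measurable.ennreal_ofReal
    _ = ∫⁻ _s in Set.Ioc (0 : ℝ) 1, ∫⁻ z in S, ENNReal.ofReal ((fderiv ℝ f z v) ^ 2) ∂μ := by
        refine lintegral_congr fun s => ?_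
        rw [← lintegral_indicator hSm, ← lintegral_indicator hSm,
          ← lintegral_add_right_eq_self
            (S.indicator fun z => ENNReal.ofReal ((fderiv ℝ f z v) ^ 2)) (s • v)]
        refine lintegral_congr fun z => ?_
        by_cases hz : z ∈ S
        · rw [Set.indicator_of_mem hz, Set.indicator_of_mem ((hS s z).2 hz)]
        · rw [Set.indicator_of_notMem hz, Set.indicator_of_notMem (fun h => hz ((hS s z).1 h))]
    _ = _ := by simp

section Grushin

variable {m k : ℕ}

instance : (volume : Measure (Em m × Em k)).IsAddHaarMeasure :=
  Measure.prod.instIsAddHaarMeasure volume volume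

/-- Partial differential in the `x`-variables. -/
def partialX (f : Em m × Em k → ℝ) (z : Em m × Em k) : Em m →L[ℝ] ℝ :=
  (fderiv ℝ f z).comp (ContinuousLinearMap.inl ℝ (Em m) (Em k))

/-- Partial differential in the `y`-variables. -/
def partialY (f : Em m × Em k → ℝ) (z : Em m × Em k) : Em k →L[ℝ] ℝ :=
  (fderiv ℝ f z).comp (ContinuousLinearMap.inr ℝ (Em m) (Em k))

theorem norm_gradX {f : Em m × Em k → ℝ} {z : Em m × Em k} (hf : DifferentiableAt ℝ f z) :
    ‖gradX f z‖ = ‖partialX f z‖ := by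
  have h : HasFDerivAt (fun x => f (x, z.2)) (partialX f z) z.1 :=
    HasFDerivAt.comp (g := f) z.1 hf.hasFDerivAt (hasFDerivAt_prodMk_left z.1 z.2)
  rw [gradX, gradient, LinearIsometryEquiv.norm_map, h.fderiv]

theorem norm_gradY {f : Em m × Em k → ℝ} {z : Em m × Em k} (hf : DifferentiableAt ℝ f z) :
    ‖gradY f z‖ = ‖partialY f z‖ := by
  have h : HasFDerivAt (fun y => f (z.1, y)) (partialY f z) z.2 :=
    HasFDerivAt.comp (g := f) z.2 hf.hasFDerivAt (hasFDerivAt_prodMk_right z.1 z.2)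
  rw [gradY, gradient, LinearIsometryEquiv.norm_map, h.fderiv]

/-- The Grushin energy density with the degenerate weight multiplied by `a`. -/
def energyDensity (a γ : ℝ) (f : Em m × Em k → ℝ) (z : Em m × Em k) : ℝ :=
  ‖partialX f z‖ ^ 2 + a ^ 2 * ‖z.1‖ ^ (2 * γ) * ‖partialY f z‖ ^ 2

theorem energyDensity_nonneg (a γ : ℝ) (f : Em m × Em k → ℝ) (z : Em m × Em k) :
    0 ≤ energyDensity a γ f z := by
  unfold energyDensity; positivity

theorem grushinSq_eq_energyDensity (γ : ℝ) {f : Em m × Em k → ℝ} {z : Em m × Em k}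
    (hf : DifferentiableAt ℝ f z) : grushinSq γ f z = energyDensity 1 γ f z := by
  rw [grushinSq, energyDensity, norm_gradX hf, norm_gradY hf]; ring

theorem lintegral_translate_x_le {f : Em m × Em k → ℝ} (hf : ContDiff ℝ 1 f) (ξ : Em m) (a γ : ℝ) :
    ∫⁻ z, ENNReal.ofReal ((f (z + (ξ, 0)) - f z) ^ 2)
      ≤ ENNReal.ofReal (‖ξ‖ ^ 2) * ∫⁻ z, ENNReal.ofReal (energyDensity a γ f z) := by
  have h := lintegral_translate_sub_sq_le (volume : Measure (Em m × Em k)) hf (ξ, 0)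
    MeasurableSet.univ (by simp)
  simp only [Measure.restrict_univ] at h
  refine h.trans ?_
  rw [← lintegral_const_mul' _ _ ENNReal.ofReal_ne_top]
  refine lintegral_mono fun z => ?_
  rw [← ENNReal.ofReal_mul (by positivity)]
  refine ENNReal.ofReal_le_ofReal ?_
  have h1 : |fderiv ℝ f z (ξ, 0)| ≤ ‖partialX f z‖ * ‖ξ‖ := by
    simpa [partialX] using (partialX f z).le_opNorm ξ
  have h2 : (fderiv ℝ f z (ξ, 0)) ^ 2 ≤ (‖partialX f z‖ * ‖ξ‖) ^ 2 := by
    rw [← sq_abs]; gcongr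
  have h3 : 0 ≤ a ^ 2 * ‖z.1‖ ^ (2 * γ) * ‖partialY f z‖ ^ 2 := by positivity
  have h4 : 0 ≤ ‖ξ‖ ^ 2 * (a ^ 2 * ‖z.1‖ ^ (2 * γ) * ‖partialY f z‖ ^ 2) := by positivity
  unfold energyDensity
  nlinarith

theorem lintegral_translate_y_le {f : Em m × Em k → ℝ} (hf : ContDiff ℝ 1 f) (η : Em k)
    {a γ t : ℝ} (ha : 0 < a) (hγ : 0 < γ) (ht : 0 < t) (hη : ‖η‖ ≤ a * t ^ (1 + γ)) :
    ∫⁻ z in {z : Em m × Em k | t ≤ ‖z.1‖}, ENNReal.ofReal ((f (z + (0, η)) - f z) ^ 2)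
      ≤ ENNReal.ofReal (t ^ 2) * ∫⁻ z, ENNReal.ofReal (energyDensity a γ f z) := by
  have hS : MeasurableSet {z : Em m × Em k | t ≤ ‖z.1‖} :=
    measurableSet_le measurable_const (by fun_prop)
  have h := lintegral_translate_sub_sq_le (volume : Measure (Em m × Em k)) hf (0, η)
    hS (by simp)
  refine h.trans ?_
  rw [← lintegral_const_mul' _ _ ENNReal.ofReal_ne_top]
  refine (setLIntegral_mono' hS fun z hz => ?_).trans (setLIntegral_le_lintegral _ _)
  rw [← ENNReal.ofReal_mul (by positivity)]
  refine ENNReal.ofReal_le_ofReal ?_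
  have h1 : |fderiv ℝ f z (0, η)| ≤ ‖partialY f z‖ * ‖η‖ := by
    simpa [partialY] using (partialY f z).le_opNorm η
  have hz' : t ^ γ ≤ ‖z.1‖ ^ γ := Real.rpow_le_rpow ht.le hz hγ.le
  have h5 : |fderiv ℝ f z (0, η)| ≤ t * (a * ‖z.1‖ ^ γ * ‖partialY f z‖) := by
    calc _ ≤ ‖partialY f z‖ * ‖η‖ := h1
      _ ≤ ‖partialY f z‖ * (a * t ^ (1 + γ)) := by gcongr
      _ = ‖partialY f z‖ * (a * (t * t ^ γ)) := by rw [Real.rpow_add ht, Real.rpow_one]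
      _ ≤ ‖partialY f z‖ * (a * (t * ‖z.1‖ ^ γ)) := by gcongr
      _ = _ := by ring
  have h2 : (fderiv ℝ f z (0, η)) ^ 2 ≤ (t * (a * ‖z.1‖ ^ γ * ‖partialY f z‖)) ^ 2 := by
    rw [← sq_abs]; gcongr
  have h6 : ‖z.1‖ ^ (2 * γ) = (‖z.1‖ ^ γ) ^ 2 := by
    rw [mul_comm, Real.rpow_mul (norm_nonneg _)]; norm_num
  unfold energyDensity
  rw [h6]
  nlinarith [sq_nonneg (t * ‖partialX f z‖)]

/-- The set of admissible displacements: outward in the direction `e` at scale `t`, and at scale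
`a * t ^ (1 + γ)` in the `y`-variables. -/
def shiftSet (k : ℕ) (e : Em m) (a γ t : ℝ) : Set (Em m × Em k) :=
  Metric.ball ((3 * t / 2) • e) (t / 2) ×ˢ Metric.ball (0 : Em k) (a * t ^ (1 + γ))

theorem exists_volume_shiftSet (m k : ℕ) : ∃ c : ℝ, 0 < c ∧ ∀ (e : Em m) {a γ t : ℝ},
    0 < a → 0 < t → volume (shiftSet k e a γ t)
      = ENNReal.ofReal (c * a ^ k * t ^ ((m : ℝ) + (γ + 1) * k)) := by
  have hm0 : volume (Metric.ball (0 : Em m) 1) ≠ 0 := (Metric.measure_ball_pos _ _ one_pos).ne'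
  have hk0 : volume (Metric.ball (0 : Em k) 1) ≠ 0 := (Metric.measure_ball_pos _ _ one_pos).ne'
  have hm1 : volume (Metric.ball (0 : Em m) 1) ≠ ⊤ := measure_ball_lt_top.ne
  have hk1 : volume (Metric.ball (0 : Em k) 1) ≠ ⊤ := measure_ball_lt_top.ne
  set A := (volume (Metric.ball (0 : Em m) 1)).toReal
  set B := (volume (Metric.ball (0 : Em k) 1)).toReal
  have hA : 0 < A := ENNReal.toReal_pos hm0 hm1
  have hB : 0 < B := ENNReal.toReal_pos hk0 hk1
  refine ⟨(1 / 2) ^ m * A * B, by positivity, fun e a γ t ha ht => ?_⟩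
  rw [shiftSet, Measure.volume_eq_prod, Measure.prod_prod,
    Measure.addHaar_ball_of_pos _ ((3 * t / 2) • e) (by positivity : 0 < t / 2),
    Measure.addHaar_ball_of_pos _ (0 : Em k) (by positivity : 0 < a * t ^ (1 + γ)),
    ← ENNReal.ofReal_toReal hm1, ← ENNReal.ofReal_toReal hk1,
    ← ENNReal.ofReal_mul (by positivity), ← ENNReal.ofReal_mul (by positivity),
    ← ENNReal.ofReal_mul (by positivity)]
  congr 1
  have hpow : t ^ ((m : ℝ) + (γ + 1) * k) = t ^ m * (t ^ (1 + γ)) ^ k := by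
    rw [Real.rpow_add ht, Real.rpow_mul ht.le, Real.rpow_natCast, Real.rpow_natCast, add_comm γ 1]
  rw [hpow]
  simp only [finrank_euclideanSpace, Fintype.card_fin]
  change (t / 2) ^ m * A * ((a * t ^ (1 + γ)) ^ k * B) = _
  rw [div_pow, mul_pow, div_pow]
  field_simp
  simp

theorem isOpen_shiftSet (e : Em m) (a γ t : ℝ) : IsOpen (shiftSet k e a γ t) :=
  Metric.isOpen_ball.prod Metric.isOpen_ball

theorem norm_fst_le_of_mem_shiftSet {e : Em m} (he : ‖e‖ = 1) {a γ t : ℝ} (ht : 0 < t)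
    {w : Em m × Em k} (hw : w ∈ shiftSet k e a γ t) : ‖w.1‖ ≤ 2 * t := by
  have h1 : ‖w.1 - (3 * t / 2) • e‖ < t / 2 := by simpa [dist_eq_norm] using hw.1
  have h2 : ‖w.1‖ ≤ ‖w.1 - (3 * t / 2) • e‖ + ‖(3 * t / 2) • e‖ := by
    simpa using norm_add_le (w.1 - (3 * t / 2) • e) ((3 * t / 2) • e)
  rw [norm_smul, he, Real.norm_of_nonneg (by positivity)] at h2
  linarith

theorem le_norm_fst_add_of_mem_shiftSet {e : Em m} (he : ‖e‖ = 1) {a γ t : ℝ}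
    {w : Em m × Em k} (hw : w ∈ shiftSet k e a γ t) {x : Em m} (hz : 0 ≤ inner ℝ e x) :
    t ≤ ‖x + w.1‖ := by
  have h1 : ‖w.1 - (3 * t / 2) • e‖ < t / 2 := by simpa [dist_eq_norm] using hw.1
  have h2 : inner ℝ e (x + w.1) ≤ ‖x + w.1‖ := by
    simpa [he] using real_inner_le_norm e (x + w.1)
  have h3 : -inner ℝ e (w.1 - (3 * t / 2) • e) ≤ ‖w.1 - (3 * t / 2) • e‖ := by
    have := real_inner_le_norm e (-(w.1 - (3 * t / 2) • e))
    rwa [inner_neg_right, norm_neg, he, one_mul] at this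
  rw [inner_sub_right, inner_smul_right, real_inner_self_eq_norm_sq, he] at h3
  rw [inner_add_right] at h2
  linarith

theorem lintegral_halfspace_translate_le {f : Em m × Em k → ℝ} (hf : ContDiff ℝ 1 f) {e : Em m}
    (he : ‖e‖ = 1) {a γ t : ℝ} (ha : 0 < a) (hγ : 0 < γ) (ht : 0 < t) {w : Em m × Em k}
    (hw : w ∈ shiftSet k e a γ t) :
    ∫⁻ z in {z : Em m × Em k | 0 ≤ inner ℝ e z.1}, ENNReal.ofReal ((f (z + w) - f z) ^ 2)
      ≤ ENNReal.ofReal (10 * t ^ 2) * ∫⁻ z, ENNReal.ofReal (energyDensity a γ f z) := by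
  have hfc := hf.continuous
  set H : Set (Em m × Em k) := {z | 0 ≤ inner ℝ e z.1} with hH
  set T : Set (Em m × Em k) := {z | t ≤ ‖z.1‖} with hT
  have hHm : MeasurableSet H := measurableSet_le measurable_const
    (Continuous.measurable (by fun_prop))
  have hTm : MeasurableSet T := measurableSet_le measurable_const (by fun_prop)
  have hsplit : ∀ z : Em m × Em k, z + w = z + (w.1, 0) + (0, w.2) := fun z => by
    ext <;> simp
  have hη : ‖w.2‖ ≤ a * t ^ (1 + γ) := by
    have := hw.2
    rw [mem_ball_zero_iff] at this
    exact this.le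
  have hX := lintegral_translate_x_le hf w.1 a γ
  have hY := lintegral_translate_y_le hf w.2 ha hγ ht hη
  set I := ∫⁻ z, ENNReal.ofReal (energyDensity a γ f z)
  set F : Em m × Em k → ENNReal := fun z => ENNReal.ofReal ((f (z + (0, w.2)) - f z) ^ 2) with hF
  have hXb : ∫⁻ z in H, ENNReal.ofReal ((f (z + (w.1, 0)) - f z) ^ 2)
      ≤ ENNReal.ofReal (4 * t ^ 2) * I := by
    refine (setLIntegral_le_lintegral _ _).trans (hX.trans ?_)
    gcongr
    have := norm_fst_le_of_mem_shiftSet he ht hw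
    nlinarith [norm_nonneg w.1]
  have hYb : ∫⁻ z in H, F (z + (w.1, 0)) ≤ ENNReal.ofReal (t ^ 2) * I := by
    refine le_trans ?_ hY
    rw [← lintegral_indicator hHm, ← lintegral_indicator hTm,
      ← lintegral_add_right_eq_self (T.indicator F) (w.1, 0)]
    refine lintegral_mono fun z => ?_
    by_cases hz : z ∈ H
    · have : z + (w.1, 0) ∈ T := le_norm_fst_add_of_mem_shiftSet he hw hz
      rw [Set.indicator_of_mem hz, Set.indicator_of_mem this]
    · rw [Set.indicator_of_notMem hz]; exact zero_le
  calc ∫⁻ z in H, ENNReal.ofReal ((f (z + w) - f z) ^ 2)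
      ≤ ∫⁻ z in H, (ENNReal.ofReal 2 * ENNReal.ofReal ((f (z + (w.1, 0)) - f z) ^ 2)
          + ENNReal.ofReal 2 * F (z + (w.1, 0))) := by
        refine lintegral_mono fun z => ?_
        rw [hF, hsplit z]
        simp only
        rw [← ENNReal.ofReal_mul (by norm_num), ← ENNReal.ofReal_mul (by norm_num),
          ← ENNReal.ofReal_add (by positivity) (by positivity)]
        refine ENNReal.ofReal_le_ofReal ?_
        nlinarith [sq_nonneg ((f (z + (w.1, 0)) - f z)
          - (f (z + (w.1, 0) + (0, w.2)) - f (z + (w.1, 0))))]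
    _ = ENNReal.ofReal 2 * (∫⁻ z in H, ENNReal.ofReal ((f (z + (w.1, 0)) - f z) ^ 2))
          + ENNReal.ofReal 2 * ∫⁻ z in H, F (z + (w.1, 0)) := by
        rw [lintegral_add_left, lintegral_const_mul' _ _ ENNReal.ofReal_ne_top,
          lintegral_const_mul' _ _ ENNReal.ofReal_ne_top]
        exact (Continuous.measurable (by fun_prop)).ennreal_ofReal.const_mul _
    _ ≤ ENNReal.ofReal 2 * (ENNReal.ofReal (4 * t ^ 2) * I)
          + ENNReal.ofReal 2 * (ENNReal.ofReal (t ^ 2) * I) := by gcongr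
    _ = ENNReal.ofReal (10 * t ^ 2) * I := by
        rw [← mul_assoc, ← mul_assoc, ← add_mul, ← ENNReal.ofReal_mul (by norm_num),
          ← ENNReal.ofReal_mul (by norm_num), ← ENNReal.ofReal_add (by positivity) (by positivity)]
        congr 2; ring

theorem halfspace_superlevel_le {f : Em m × Em k → ℝ} (hf : ContDiff ℝ 1 f)
    (hf0 : ∀ z, 0 ≤ f z) {e : Em m} (he : ‖e‖ = 1) {a γ t L : ℝ} (ha : 0 < a) (hγ : 0 < γ)
    (ht : 0 < t) (hL : 0 < L)
    (hbound : 4 * ∫⁻ z, ENNReal.ofReal (f z) ≤ ENNReal.ofReal L * volume (shiftSet k e a γ t)) :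
    ENNReal.ofReal (L ^ 2) * volume {z : Em m × Em k | 0 ≤ inner ℝ e z.1 ∧ L ≤ f z}
      ≤ ENNReal.ofReal (20 * t ^ 2) * ∫⁻ z, ENNReal.ofReal (energyDensity a γ f z) := by
  have hfc := hf.continuous
  set W := shiftSet k e a γ t with hW
  set I := ∫⁻ z, ENNReal.ofReal (energyDensity a γ f z)
  set H : Set (Em m × Em k) := {z | 0 ≤ inner ℝ e z.1} with hH
  have hHm : MeasurableSet H := measurableSet_le measurable_const
    (Continuous.measurable (by fun_prop))
  have hLm : MeasurableSet {z : Em m × Em k | L ≤ f z} :=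
    measurableSet_le measurable_const hfc.measurable
  set S : Set (Em m × Em k) := {z | 0 ≤ inner ℝ e z.1 ∧ L ≤ f z} with hS
  have hSm : MeasurableSet S := hHm.inter hLm
  have hWm : MeasurableSet W := (isOpen_shiftSet e a γ t).measurableSet
  obtain ⟨c, hc, hvol⟩ := exists_volume_shiftSet m k
  have hWv : volume W = ENNReal.ofReal (c * a ^ k * t ^ ((m : ℝ) + (γ + 1) * k)) := hvol e ha ht
  have hW0 : volume W ≠ 0 := by
    rw [hWv]; simp only [ne_eq, ENNReal.ofReal_eq_zero, not_le]; positivity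
  have hWt : volume W ≠ ⊤ := by rw [hWv]; exact ENNReal.ofReal_ne_top
  set X := ENNReal.ofReal (L ^ 2 / 2) * volume W with hX
  have hXt : X ≠ ⊤ := ENNReal.mul_ne_top ENNReal.ofReal_ne_top hWt
  have hpt : ∀ z ∈ S, X ≤ ∫⁻ w in W, ENNReal.ofReal ((f (z + w) - f z) ^ 2) := by
    intro z hz
    refine ENNReal.le_of_add_le_add_right hXt ?_
    calc X + X = ∫⁻ _w in W, ENNReal.ofReal (L ^ 2) := by
          rw [setLIntegral_const, hX, ← add_mul, ← ENNReal.ofReal_add (by positivity)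
            (by positivity)]
          congr 2; ring
      _ ≤ ∫⁻ w in W, (ENNReal.ofReal ((f (z + w) - f z) ^ 2)
            + ENNReal.ofReal (2 * L) * ENNReal.ofReal (f (z + w))) := by
          refine lintegral_mono fun w => ?_
          rw [← ENNReal.ofReal_mul (by positivity),
            ← ENNReal.ofReal_add (by positivity)
              (mul_nonneg (by positivity) (hf0 _))]
          refine ENNReal.ofReal_le_ofReal ?_
          have h1 : L ≤ f z := hz.2
          have h2 := hf0 (z + w)
          rcases le_total (f (z + w)) L with h | h
          · nlinarith
          · nlinarith [sq_nonneg (f (z + w) - f z)]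
      _ = (∫⁻ w in W, ENNReal.ofReal ((f (z + w) - f z) ^ 2))
            + ENNReal.ofReal (2 * L) * ∫⁻ w in W, ENNReal.ofReal (f (z + w)) := by
          rw [lintegral_add_left (Continuous.measurable (by fun_prop)).ennreal_ofReal,
            lintegral_const_mul' _ _ ENNReal.ofReal_ne_top]
      _ ≤ _ := by
          gcongr
          have h1 : ∫⁻ w in W, ENNReal.ofReal (f (z + w)) ≤ ∫⁻ z, ENNReal.ofReal (f z) := by
            refine (setLIntegral_le_lintegral _ _).trans (le_of_eq ?_)
            exact lintegral_add_left_eq_self (fun z => ENNReal.ofReal (f z)) z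
          have h4 : ENNReal.ofReal (2 * L) = ENNReal.ofReal (L / 2) * 4 := by
            have : (4 : ENNReal) = ENNReal.ofReal 4 := by simp
            rw [this, ← ENNReal.ofReal_mul (by positivity)]; congr 1; ring
          calc _ ≤ ENNReal.ofReal (2 * L) * ∫⁻ z, ENNReal.ofReal (f z) := by gcongr
            _ = ENNReal.ofReal (L / 2) * (4 * ∫⁻ z, ENNReal.ofReal (f z)) := by
                rw [h4, mul_assoc]
            _ ≤ ENNReal.ofReal (L / 2) * (ENNReal.ofReal L * volume W) := by gcongr
            _ = X := by
                rw [← mul_assoc, ← ENNReal.ofReal_mul (by positivity), hX]; congr 2; ring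
  have hmain : volume W * (ENNReal.ofReal (L ^ 2 / 2) * volume S)
      ≤ volume W * (ENNReal.ofReal (10 * t ^ 2) * I) := by
    calc volume W * (ENNReal.ofReal (L ^ 2 / 2) * volume S) = ∫⁻ _z in S, X := by
          rw [setLIntegral_const, hX]; ring
      _ ≤ ∫⁻ z in S, ∫⁻ w in W, ENNReal.ofReal ((f (z + w) - f z) ^ 2) :=
          setLIntegral_mono' hSm hpt
      _ ≤ ∫⁻ z in H, ∫⁻ w in W, ENNReal.ofReal ((f (z + w) - f z) ^ 2) :=
          lintegral_mono_set fun z hz => hz.1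
      _ = ∫⁻ w in W, ∫⁻ z in H, ENNReal.ofReal ((f (z + w) - f z) ^ 2) := by
          refine lintegral_lintegral_swap (Measurable.aemeasurable ?_)
          exact (Continuous.measurable (f := fun q : (Em m × Em k) × (Em m × Em k) =>
            (f (q.1 + q.2) - f q.1) ^ 2) (by fun_prop)).ennreal_ofReal
      _ ≤ ∫⁻ _w in W, ENNReal.ofReal (10 * t ^ 2) * I :=
          setLIntegral_mono' hWm fun w hw =>
            lintegral_halfspace_translate_le hf he ha hγ ht hw
      _ = _ := by rw [setLIntegral_const, mul_comm]
  have h := (ENNReal.mul_le_mul_iff_right hW0 hWt).1 hmain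
  calc _ = ENNReal.ofReal 2 * (ENNReal.ofReal (L ^ 2 / 2) * volume S) := by
        rw [← mul_assoc, ← ENNReal.ofReal_mul (by norm_num)]; congr 2; ring
    _ ≤ ENNReal.ofReal 2 * (ENNReal.ofReal (10 * t ^ 2) * I) := by gcongr
    _ = _ := by
        rw [← mul_assoc, ← ENNReal.ofReal_mul (by norm_num)]; congr 2; ring

theorem exists_superlevel_le (hm : 1 ≤ m) (k : ℕ) : ∃ c : ℝ, 0 < c ∧
    ∀ {f : Em m × Em k → ℝ} {a γ t L : ℝ}, ContDiff ℝ 1 f → (∀ z, 0 ≤ f z) → 0 < a → 0 < γ →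
      0 < t → 0 < L →
      (4 * ∫⁻ z, ENNReal.ofReal (f z)
        ≤ ENNReal.ofReal (L * (c * a ^ k * t ^ ((m : ℝ) + (γ + 1) * k)))) →
      ENNReal.ofReal (L ^ 2) * volume {z : Em m × Em k | L ≤ f z}
        ≤ ENNReal.ofReal (40 * t ^ 2) * ∫⁻ z, ENNReal.ofReal (energyDensity a γ f z) := by
  obtain ⟨c, hc, hvol⟩ := exists_volume_shiftSet m k
  refine ⟨c, hc, fun {f a γ t L} hf hf0 ha hγ ht hL hbound => ?_⟩
  set e : Em m := EuclideanSpace.single ⟨0, hm⟩ 1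
  have he : ‖e‖ = 1 := by simp [e]
  have key : ∀ e : Em m, ‖e‖ = 1 →
      ENNReal.ofReal (L ^ 2) * volume {z : Em m × Em k | 0 ≤ inner ℝ e z.1 ∧ L ≤ f z}
      ≤ ENNReal.ofReal (20 * t ^ 2) * ∫⁻ z, ENNReal.ofReal (energyDensity a γ f z) :=
    fun e he => halfspace_superlevel_le hf hf0 he ha hγ ht hL (by
      rw [hvol e ha ht, ← ENNReal.ofReal_mul hL.le]; exact hbound)
  have hsub : {z : Em m × Em k | L ≤ f z} ⊆ {z | 0 ≤ inner ℝ e z.1 ∧ L ≤ f z}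
      ∪ {z | 0 ≤ inner ℝ (-e) z.1 ∧ L ≤ f z} := by
    intro z hz
    rcases le_total 0 (inner ℝ e z.1) with h | h
    · exact Or.inl ⟨h, hz⟩
    · exact Or.inr ⟨by rw [inner_neg_left]; linarith, hz⟩
  calc _ ≤ ENNReal.ofReal (L ^ 2) * (volume {z : Em m × Em k | 0 ≤ inner ℝ e z.1 ∧ L ≤ f z}
        + volume {z : Em m × Em k | 0 ≤ inner ℝ (-e) z.1 ∧ L ≤ f z}) := by
        gcongr; exact (measure_mono hsub).trans (measure_union_le _ _)
    _ ≤ ENNReal.ofReal (20 * t ^ 2) * (∫⁻ z, ENNReal.ofReal (energyDensity a γ f z))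
        + ENNReal.ofReal (20 * t ^ 2) * ∫⁻ z, ENNReal.ofReal (energyDensity a γ f z) := by
        rw [mul_add]; exact add_le_add (key e he) (key (-e) (by rwa [norm_neg]))
    _ = _ := by
        rw [← add_mul, ← ENNReal.ofReal_add (by positivity) (by positivity)]; congr 2; ring

theorem exists_deriv_bound_contDiffBump {c : ℝ} (b : ContDiffBump c) :
    ∃ K : ℝ, 0 < K ∧ ∀ s, |deriv b s| ≤ K := by
  have hc : Continuous (deriv b) := (b.contDiff (n := 1)).continuous_deriv (by norm_num)
  obtain ⟨K, hK⟩ := hc.bounded_above_of_compact_support b.hasCompactSupport.deriv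
  exact ⟨max K 1, by positivity, fun s => (hK s).trans (le_max_left _ _)⟩

theorem exists_smooth_truncation : ∃ (φ : ℝ → ℝ) (K : ℝ), ContDiff ℝ 1 φ ∧ (∀ s, 0 ≤ φ s) ∧
    (∀ s, φ s ≤ 1) ∧ (∀ s, |s| < 1 → φ s = 0) ∧ (∀ s, 2 ≤ |s| → φ s = 1) ∧ 0 < K ∧
    (∀ s, |deriv φ s| ≤ K) ∧ ∀ s, ¬(1 ≤ |s| ∧ |s| < 2) → deriv φ s = 0 := by
  let b : ContDiffBump (0 : ℝ) := ⟨1, 2, one_pos, one_lt_two⟩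
  obtain ⟨K, hK, hbK⟩ := exists_deriv_bound_contDiffBump b
  have hφ0 : ∀ s : ℝ, |s| < 1 → 1 - b s = 0 := fun s hs => by
    rw [b.one_of_mem_closedBall (by simpa [b] using hs.le), sub_self]
  have hφ1 : ∀ s : ℝ, 2 ≤ |s| → 1 - b s = 1 := fun s hs => by
    rw [b.zero_of_le_dist (by simpa [b] using hs), sub_zero]
  refine ⟨fun s => 1 - b s, K, contDiff_const.sub b.contDiff, fun s => by
    simpa using b.le_one, fun s => by simpa using b.nonneg, hφ0, hφ1, hK, fun s => ?_,
    fun s hs => ?_⟩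
  · rw [deriv_const_sub, abs_neg]; exact hbK s
  · rcases lt_or_ge |s| 1 with h | h
    · refine IsLocalMin.deriv_eq_zero (Eventually.of_forall fun r => ?_)
      simp only [hφ0 s h]
      simpa using b.le_one
    · have h2 : 2 ≤ |s| := by
        by_contra h3; exact hs ⟨h, not_le.1 h3⟩
      refine IsLocalMax.deriv_eq_zero (Eventually.of_forall fun r => ?_)
      simp only [hφ1 s h2]
      simpa using b.nonneg

theorem energyDensity_comp {v : Em m × Em k → ℝ} {ψ : ℝ → ℝ} {z : Em m × Em k}
    (hv : DifferentiableAt ℝ v z) (hψ : DifferentiableAt ℝ ψ (v z)) (a γ : ℝ) :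
    energyDensity a γ (fun z => ψ (v z)) z
      = deriv ψ (v z) ^ 2 * energyDensity a γ v z := by
  have h : fderiv ℝ (fun z => ψ (v z)) z = deriv ψ (v z) • fderiv ℝ v z :=
    (hψ.hasDerivAt.comp_hasFDerivAt z hv.hasFDerivAt).fderiv
  simp only [energyDensity, partialX, partialY, h, ContinuousLinearMap.smul_comp, norm_smul,
    mul_pow, Real.norm_eq_abs, sq_abs]
  ring

theorem exists_superlevel_double_le (hm : 1 ≤ m) (k : ℕ) : ∃ c K : ℝ, 0 < c ∧ 0 < K ∧
    ∀ {v : Em m × Em k → ℝ} {a γ t L : ℝ}, ContDiff ℝ 1 v → 0 < a → 0 < γ →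
      0 < t → 0 < L →
      (4 * volume {z | L ≤ |v z|}
        ≤ ENNReal.ofReal (c * a ^ k * t ^ ((m : ℝ) + (γ + 1) * k))) →
      ENNReal.ofReal (L ^ 2) * volume {z : Em m × Em k | 2 * L ≤ |v z|}
        ≤ ENNReal.ofReal (K * t ^ 2)
          * ∫⁻ z in {z | L ≤ |v z| ∧ |v z| < 2 * L}, ENNReal.ofReal (energyDensity a γ v z) := by
  obtain ⟨c, hc, H⟩ := exists_superlevel_le hm k
  obtain ⟨φ, K, hφ, hφn, hφl, hφ0, hφ1, hK, hφK, hφd⟩ := exists_smooth_truncation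
  refine ⟨c, 40 * K ^ 2, hc, by positivity, fun {v a γ t L} hv ha hγ ht hL hvol => ?_⟩
  have hAm : MeasurableSet {z | L ≤ |v z| ∧ |v z| < 2 * L} :=
    (measurableSet_le measurable_const hv.continuous.abs.measurable).inter
      (measurableSet_lt hv.continuous.abs.measurable measurable_const)
  have hBm : MeasurableSet {z | L ≤ |v z|} :=
    measurableSet_le measurable_const hv.continuous.abs.measurable
  set ψ : ℝ → ℝ := fun s => L * φ (s / L) with hψdef
  have hψ : ContDiff ℝ 1 ψ := contDiff_const.mul (hφ.comp (contDiff_id.div_const L))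
  have hψd : ∀ s, deriv ψ s = deriv φ (s / L) := by
    intro s
    have h1 : HasDerivAt (fun s : ℝ => s / L) (1 / L) s := (hasDerivAt_id s).div_const L
    have h2 := ((hφ.differentiable (by norm_num)) (s / L)).hasDerivAt
    have h3 := (h2.comp s h1).const_mul L
    have h4 : deriv ψ s = L * (deriv φ (s / L) * (1 / L)) := h3.deriv
    rw [h4]; field_simp
  have habs : ∀ s, |s / L| = |s| / L := fun s => by rw [abs_div, abs_of_pos hL]
  have hbound : ∫⁻ z, ENNReal.ofReal (ψ (v z)) ≤ ENNReal.ofReal L * volume {z | L ≤ |v z|} := by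
    rw [← lintegral_indicator_const hBm]
    refine lintegral_mono fun z => ?_
    by_cases hz : L ≤ |v z|
    · rw [Set.indicator_of_mem (by exact hz)]
      exact ENNReal.ofReal_le_ofReal (mul_le_of_le_one_right hL.le (hφl _))
    · have : φ (v z / L) = 0 := hφ0 _ (by rw [habs, div_lt_one hL]; exact not_le.1 hz)
      simp [hψdef, this]
  have key := H (f := fun z => ψ (v z)) (hψ.comp hv)
    (fun z => mul_nonneg hL.le (hφn _)) ha hγ ht hL (by
      rw [ENNReal.ofReal_mul hL.le]
      calc _ ≤ 4 * (ENNReal.ofReal L * volume {z | L ≤ |v z|}) := by gcongr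
        _ = ENNReal.ofReal L * (4 * volume {z | L ≤ |v z|}) := by ring
        _ ≤ _ := by gcongr)
  calc _ ≤ ENNReal.ofReal (L ^ 2) * volume {z : Em m × Em k | L ≤ ψ (v z)} := by
        refine mul_le_mul_right (measure_mono fun z h => ?_) _
        have : φ (v z / L) = 1 := hφ1 _ (by rw [habs, le_div_iff₀ hL]; exact h)
        simp [hψdef, this]
    _ ≤ _ := key
    _ ≤ ENNReal.ofReal (40 * t ^ 2) * (ENNReal.ofReal (K ^ 2)
          * ∫⁻ z in {z | L ≤ |v z| ∧ |v z| < 2 * L}, ENNReal.ofReal (energyDensity a γ v z)) := by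
        gcongr
        rw [← lintegral_const_mul' _ _ ENNReal.ofReal_ne_top, ← lintegral_indicator hAm]
        refine lintegral_mono fun z => ?_
        simp only
        rw [energyDensity_comp ((hv.differentiable (by norm_num)) z)
          ((hψ.differentiable (by norm_num)) _), hψd]
        by_cases hz : L ≤ |v z| ∧ |v z| < 2 * L
        · rw [Set.indicator_of_mem (by exact hz), ← ENNReal.ofReal_mul (by positivity)]
          refine ENNReal.ofReal_le_ofReal ?_
          refine mul_le_mul_of_nonneg_right ?_ (energyDensity_nonneg _ _ _ _)
          rw [← sq_abs]
          have := hφK (v z / L)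
          gcongr
        · rw [hφd _ (by rwa [habs, le_div_iff₀ hL, div_lt_iff₀ hL, one_mul])]
          simp
    _ = _ := by
        rw [← mul_assoc, ← ENNReal.ofReal_mul (by positivity)]; congr 2; ring

theorem exists_lintegral_twoStar_le (hm : 1 ≤ m) (k : ℕ) {γ : ℝ} (hγ : 0 < γ)
    (hν : 2 < (m : ℝ) + (γ + 1) * k) : ∃ C : ℝ, 0 < C ∧
    ∀ {v : Em m × Em k → ℝ} {a : ℝ}, ContDiff ℝ 1 v → HasCompactSupport v → 0 < a →
      (∫⁻ z, ENNReal.ofReal (|v z| ^ twoStar m k γ)) ^ (2 / twoStar m k γ)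
        ≤ ENNReal.ofReal (C * a ^ (-(2 * k / ((m : ℝ) + (γ + 1) * k))))
          * ∫⁻ z, ENNReal.ofReal (energyDensity a γ v z) := by
  obtain ⟨c, K, hc, hK, H⟩ := exists_superlevel_double_le hm k
  set ν : ℝ := (m : ℝ) + (γ + 1) * k with hνdef
  set q : ℝ := twoStar m k γ with hqdef
  have hq : q = 2 * ν / (ν - 2) := rfl
  have hν2 : 0 < ν - 2 := by linarith
  have hq0 : 0 < q := by rw [hq]; positivity
  have hq1 : 2 / q = 1 - 2 / ν := by rw [hq]; field_simp
  have hq2 : q = 2 + q * (2 / ν) := by rw [hq]; field_simp; ring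
  refine ⟨4 ^ q * K * (4 / c) ^ (2 / ν), by positivity, fun {v a} hv hvs ha => ?_⟩
  have hvc := hv.continuous
  have hSfin : ∫⁻ z, ENNReal.ofReal (|v z| ^ q) ≠ ⊤ := by
    have hcs : HasCompactSupport fun z => |v z| ^ q :=
      hvs.comp_left (g := fun s : ℝ => |s| ^ q) (by simp [hq0.ne'])
    have hcc : Continuous fun z => |v z| ^ q :=
      hvc.abs.rpow_const fun _ => Or.inr hq0.le
    have hi := hcc.integrable_of_hasCompactSupport (μ := volume) hcs
    exact (hi.lintegral_lt_top).ne
  set S := (∫⁻ z, ENNReal.ofReal (|v z| ^ q)).toReal with hS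
  have hSeq : ∫⁻ z, ENNReal.ofReal (|v z| ^ q) = ENNReal.ofReal S :=
    (ENNReal.ofReal_toReal hSfin).symm
  set I := ∫⁻ z, ENNReal.ofReal (energyDensity a γ v z) with hI
  rw [hSeq]
  have hSnn : 0 ≤ S := ENNReal.toReal_nonneg
  rcases hSnn.eq_or_lt with h0 | hS0
  · rw [← h0]
    simp [hq0]
  set D : ℝ := (4 * S / (c * a ^ k)) ^ (2 / ν) with hD
  have hD0 : 0 < D := by positivity
  have hlevel : ∀ L : ℝ, 0 < L →
      ENNReal.ofReal (L ^ q) * volume {z : Em m × Em k | 2 * L ≤ |v z|}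
        ≤ ENNReal.ofReal (K * D)
          * ∫⁻ z in {z | L ≤ |v z| ∧ |v z| < 2 * L},
              ENNReal.ofReal (energyDensity a γ v z) := by
    intro L hL
    have hmark : ENNReal.ofReal (L ^ q) * volume {z | L ≤ |v z|} ≤ ENNReal.ofReal S := by
      rw [← hSeq]
      refine le_trans ?_ (mul_meas_ge_le_lintegral
        (hvc.abs.rpow_const fun _ => Or.inr hq0.le).measurable.ennreal_ofReal
          (ENNReal.ofReal (L ^ q)))
      gcongr
      intro hz
      exact ENNReal.ofReal_le_ofReal (Real.rpow_le_rpow hL.le hz hq0.le)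
    have hLq : 0 < L ^ q := by positivity
    set t : ℝ := (4 * S / (c * a ^ k) * L ^ (-q)) ^ (1 / ν) with ht
    have ht0 : 0 < t := by positivity
    have htν : t ^ ν = 4 * S / (c * a ^ k) * L ^ (-q) := by
      rw [ht, ← Real.rpow_mul (by positivity), one_div_mul_cancel (by linarith), Real.rpow_one]
    have ht2 : t ^ 2 = D * L ^ (-(q * (2 / ν))) := by
      rw [ht, ← Real.rpow_natCast, ← Real.rpow_mul (by positivity),
        Real.mul_rpow (by positivity) (by positivity), ← Real.rpow_mul hL.le, hD]
      congr 2 <;> push_cast <;> ring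
    have h := H hv ha hγ ht0 hL (by
      rw [← hνdef, htν]
      have h1 : volume {z | L ≤ |v z|} ≤ ENNReal.ofReal (S * L ^ (-q)) := by
        rw [Real.rpow_neg hL.le, ← div_eq_mul_inv, ENNReal.ofReal_div_of_pos hLq]
        rw [ENNReal.le_div_iff_mul_le (Or.inl (by simpa using hLq))
          (Or.inl ENNReal.ofReal_ne_top), mul_comm]
        exact hmark
      have h4 : ENNReal.ofReal (c * a ^ k * (4 * S / (c * a ^ k) * L ^ (-q)))
          = 4 * ENNReal.ofReal (S * L ^ (-q)) := by
        rw [show (4 : ENNReal) = ENNReal.ofReal 4 by simp, ← ENNReal.ofReal_mul (by norm_num)]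
        congr 1; field_simp
      rw [h4]
      gcongr)
    have hfac : ENNReal.ofReal (L ^ q)
        = ENNReal.ofReal (L ^ (q * (2 / ν))) * ENNReal.ofReal (L ^ 2) := by
      rw [← ENNReal.ofReal_mul (by positivity), ← Real.rpow_natCast, ← Real.rpow_add hL]
      congr 2; push_cast; linarith
    rw [hfac, mul_assoc]
    calc _ ≤ ENNReal.ofReal (L ^ (q * (2 / ν))) * _ := mul_le_mul_right h _
      _ = _ := by
        rw [← mul_assoc, ← ENNReal.ofReal_mul (by positivity), ht2]
        congr 2
        rw [Real.rpow_neg hL.le]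
        have : 0 < L ^ (q * (2 / ν)) := by positivity
        field_simp
  have h2 : ∀ n : ℤ, (0 : ℝ) < 2 ^ n := fun n => by positivity
  set A : ℤ → Set (Em m × Em k) := fun n => {z | (2 : ℝ) ^ n ≤ |v z| ∧ |v z| < 2 * 2 ^ n} with hA
  have hAm : ∀ n, MeasurableSet (A n) := fun n =>
    (measurableSet_le measurable_const hvc.abs.measurable).inter
      (measurableSet_lt hvc.abs.measurable measurable_const)
  have hAdisj : Pairwise (Function.onFun Disjoint A) := by
    intro i j hij
    rw [Function.onFun, Set.disjoint_left]
    rintro z ⟨hi1, hi2⟩ ⟨hj1, hj2⟩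
    rw [← zpow_one_add₀ (by norm_num : (2 : ℝ) ≠ 0)] at hi2 hj2
    have e1 := (zpow_lt_zpow_iff_right₀ (by norm_num : (1 : ℝ) < 2)).1 (hi1.trans_lt hj2)
    have e2 := (zpow_lt_zpow_iff_right₀ (by norm_num : (1 : ℝ) < 2)).1 (hj1.trans_lt hi2)
    omega
  have hsum : ∑' n, ∫⁻ z in A n, ENNReal.ofReal (energyDensity a γ v z) ≤ I := by
    rw [← lintegral_iUnion hAm hAdisj]
    exact setLIntegral_le_lintegral _ _
  have hcover : ∀ z, v z ≠ 0 → ∃ n : ℤ, z ∈ A (n + 1) := by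
    intro z hz
    obtain ⟨n, hn1, hn2⟩ := exists_mem_Ico_zpow (abs_pos.2 hz) (by norm_num : (1 : ℝ) < 2)
    refine ⟨n - 1, ?_, ?_⟩
    · rwa [sub_add_cancel]
    · rwa [sub_add_cancel, ← zpow_one_add₀ (by norm_num : (2 : ℝ) ≠ 0), add_comm]
  have hSle : ENNReal.ofReal S ≤ ENNReal.ofReal (4 ^ q * (K * D)) * I := by
    rw [← hSeq]
    calc ∫⁻ z, ENNReal.ofReal (|v z| ^ q)
        ≤ ∫⁻ z in ⋃ n : ℤ, A (n + 1), ENNReal.ofReal (|v z| ^ q) := by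
          rw [← lintegral_indicator (MeasurableSet.iUnion fun n => hAm (n + 1))]
          refine lintegral_mono fun z => ?_
          by_cases hz : v z = 0
          · simp [hz, hq0.ne']
          · rw [Set.indicator_of_mem (Set.mem_iUnion.2 (hcover z hz))]
      _ ≤ ∑' n : ℤ, ∫⁻ z in A (n + 1), ENNReal.ofReal (|v z| ^ q) := lintegral_iUnion_le _ _
      _ ≤ ∑' n : ℤ, ENNReal.ofReal (4 ^ q * (K * D))
            * ∫⁻ z in A n, ENNReal.ofReal (energyDensity a γ v z) := by
          refine ENNReal.tsum_le_tsum fun n => ?_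
          have hz1 : (2 : ℝ) ^ (n + 1) = 2 * 2 ^ n := by
            rw [zpow_add_one₀ (by norm_num), mul_comm]
          calc _ ≤ ∫⁻ z in A (n + 1), ENNReal.ofReal ((4 * 2 ^ n) ^ q) := by
                refine setLIntegral_mono' (hAm _) fun z hz => ?_
                refine ENNReal.ofReal_le_ofReal (Real.rpow_le_rpow (abs_nonneg _) ?_ hq0.le)
                have := hz.2
                rw [hz1] at this
                linarith
            _ ≤ ENNReal.ofReal ((4 * 2 ^ n) ^ q) * volume {z | 2 * (2 : ℝ) ^ n ≤ |v z|} := by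
                rw [setLIntegral_const]
                gcongr
                rw [← hz1]
                exact fun z hz => hz.1
            _ = ENNReal.ofReal (4 ^ q) * (ENNReal.ofReal (((2 : ℝ) ^ n) ^ q)
                  * volume {z | 2 * (2 : ℝ) ^ n ≤ |v z|}) := by
                rw [Real.mul_rpow (by norm_num) (h2 n).le, ENNReal.ofReal_mul (by positivity),
                  mul_assoc]
            _ ≤ ENNReal.ofReal (4 ^ q) * _ := mul_le_mul_right (hlevel _ (h2 n)) _
            _ = _ := by rw [← mul_assoc, ← ENNReal.ofReal_mul (by positivity)]
      _ ≤ _ := by rw [ENNReal.tsum_mul_left]; gcongr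
  rw [ENNReal.ofReal_rpow_of_pos hS0, hq1]
  have hs : ENNReal.ofReal (S ^ (1 - 2 / ν)) = ENNReal.ofReal (S ^ (-(2 / ν))) * ENNReal.ofReal S := by
    rw [← ENNReal.ofReal_mul (by positivity), sub_eq_neg_add, Real.rpow_add hS0, Real.rpow_one]
  rw [hs]
  refine (mul_le_mul_right hSle _).trans (le_of_eq ?_)
  rw [← mul_assoc, ← ENNReal.ofReal_mul (by positivity)]
  congr 2
  have hDe : D = (4 / c) ^ (2 / ν) * S ^ (2 / ν) * a ^ (-(2 * k / ν)) := by
    have : 4 * S / (c * a ^ k) = 4 / c * S * a ^ (-(k : ℝ)) := by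
      rw [Real.rpow_neg ha.le, Real.rpow_natCast]; field_simp
    rw [hD, this, Real.mul_rpow (by positivity) (by positivity),
      Real.mul_rpow (by positivity) (by positivity), ← Real.rpow_mul ha.le]
    congr 2; ring
  rw [hDe, Real.rpow_neg hS0.le]
  have : 0 < S ^ (2 / ν) := by positivity
  field_simp

theorem lintegral_abs_rpow_interpolation {Ω : Type*} [MeasurableSpace Ω] (μ : Measure Ω)
    {v : Ω → ℝ} (hv : Measurable v) {p q : ℝ} (hp : 2 ≤ p) (hpq : p ≤ q) (hq : 2 < q) :
    ∫⁻ z, ENNReal.ofReal (|v z| ^ p) ∂μ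
      ≤ (∫⁻ z, ENNReal.ofReal (v z ^ 2) ∂μ) ^ ((q - p) / (q - 2))
        * (∫⁻ z, ENNReal.ofReal (|v z| ^ q) ∂μ) ^ ((p - 2) / (q - 2)) := by
  have hq2 : 0 < q - 2 := by linarith
  have hθ : 0 ≤ (q - p) / (q - 2) := div_nonneg (by linarith) hq2.le
  have hθ' : 0 ≤ (p - 2) / (q - 2) := div_nonneg (by linarith) hq2.le
  refine le_trans (lintegral_mono fun z => ?_) (ENNReal.lintegral_mul_norm_pow_le
    (hv.pow_const 2).ennreal_ofReal.aemeasurable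
    (hv.abs.pow_const q).ennreal_ofReal.aemeasurable hθ hθ' (by field_simp; ring))
  rcases (abs_nonneg (v z)).eq_or_lt with h | h
  · rw [← h, Real.zero_rpow (by linarith), ENNReal.ofReal_zero]
    exact zero_le
  · simp only
    rw [← sq_abs, ENNReal.ofReal_rpow_of_nonneg (by positivity) hθ,
      ENNReal.ofReal_rpow_of_nonneg (by positivity) hθ', ← ENNReal.ofReal_mul (by positivity)]
    refine le_of_eq (congrArg _ ?_)
    rw [← Real.rpow_natCast, ← Real.rpow_mul h.le, ← Real.rpow_mul h.le, ← Real.rpow_add h]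
    congr 1
    field_simp
    push_cast
    ring

/-- The smooth function `1 + |z|²`. -/
def japaneseSq (z : Em m × Em k) : ℝ := 1 + ‖z.1‖ ^ 2 + ‖z.2‖ ^ 2

theorem one_le_japaneseSq (z : Em m × Em k) : 1 ≤ japaneseSq z := by
  unfold japaneseSq; nlinarith [sq_nonneg ‖z.1‖, sq_nonneg ‖z.2‖]

theorem contDiff_japaneseSq : ContDiff ℝ 1 (japaneseSq (m := m) (k := k)) :=
  (contDiff_const.add (contDiff_fst.norm_sq ℝ)).add (contDiff_snd.norm_sq ℝ)

theorem norm_fderiv_japaneseSq_sq_le (z : Em m × Em k) :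
    ‖fderiv ℝ japaneseSq z‖ ^ 2 ≤ 16 * japaneseSq z := by
  have h1 : HasFDerivAt (fun z : Em m × Em k => ‖z.1‖ ^ 2) _ z := hasFDerivAt_fst.norm_sq
  have h2 : HasFDerivAt (fun z : Em m × Em k => ‖z.2‖ ^ 2) _ z := hasFDerivAt_snd.norm_sq
  have h : HasFDerivAt (japaneseSq (m := m) (k := k)) _ z := (h1.const_add 1).add h2
  have hb : ‖fderiv ℝ japaneseSq z‖ ≤ 2 * ‖z.1‖ + 2 * ‖z.2‖ := by
    refine ContinuousLinearMap.opNorm_le_bound _ (by positivity) fun w => ?_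
    rw [h.fderiv]
    have e1 := abs_real_inner_le_norm z.1 w.1
    have e2 := abs_real_inner_le_norm z.2 w.2
    have e3 : ‖w.1‖ ≤ ‖w‖ := norm_fst_le w
    have e4 : ‖w.2‖ ≤ ‖w‖ := norm_snd_le w
    simp only [_root_.add_apply, _root_.smul_apply,
      ContinuousLinearMap.comp_apply, innerSL_apply_apply, ContinuousLinearMap.coe_fst',
      ContinuousLinearMap.coe_snd', Real.norm_eq_abs, nsmul_eq_mul, Nat.cast_ofNat]
    calc _ ≤ |2 * inner ℝ z.1 w.1| + |2 * inner ℝ z.2 w.2| := abs_add_le _ _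
      _ = 2 * |inner ℝ z.1 w.1| + 2 * |inner ℝ z.2 w.2| := by
          rw [abs_mul, abs_mul]; norm_num
      _ ≤ 2 * (‖z.1‖ * ‖w‖) + 2 * (‖z.2‖ * ‖w‖) := by
          have e5 := mul_le_mul_of_nonneg_left e3 (norm_nonneg z.1)
          have e6 := mul_le_mul_of_nonneg_left e4 (norm_nonneg z.2)
          linarith
      _ = _ := by ring
  have hb2 := pow_le_pow_left₀ (norm_nonneg _) hb 2
  refine hb2.trans ?_
  unfold japaneseSq
  nlinarith [sq_nonneg (‖z.1‖ - ‖z.2‖), sq_nonneg ‖z.1‖, sq_nonneg ‖z.2‖]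

theorem japaneseSq_le_one_add_pnorm_sq (z : Em m × Em k) :
    japaneseSq z ≤ (1 + pnorm z) ^ 2 ∧ (1 + pnorm z) ^ 2 ≤ 2 * japaneseSq z := by
  have h0 : 0 ≤ pnorm z := Real.sqrt_nonneg _
  have h1 : pnorm z ^ 2 = ‖z.1‖ ^ 2 + ‖z.2‖ ^ 2 := Real.sq_sqrt (by positivity)
  unfold japaneseSq
  constructor <;> nlinarith [sq_nonneg (pnorm z - 1)]

/-- A closed shell on which `1 + |z|` is comparable to `R`. -/
def shell (m k : ℕ) (R : ℝ) : Set (Em m × Em k) :=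
  {z | R ^ 2 / 2 ≤ japaneseSq z ∧ japaneseSq z ≤ 9 / 2 * R ^ 2}

theorem measurableSet_shell (R : ℝ) : MeasurableSet (shell m k R) :=
  (measurableSet_le measurable_const contDiff_japaneseSq.continuous.measurable).inter
    (measurableSet_le contDiff_japaneseSq.continuous.measurable measurable_const)

theorem one_add_pnorm_comparable {R : ℝ} (hR : 0 < R) {z : Em m × Em k} (hz : z ∈ shell m k R) :
    R / 4 ≤ 1 + pnorm z ∧ 1 + pnorm z ≤ 4 * R := by
  have h0 : 0 ≤ pnorm z := Real.sqrt_nonneg _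
  obtain ⟨h1, h2⟩ := japaneseSq_le_one_add_pnorm_sq z
  obtain ⟨h3, h4⟩ := hz
  constructor
  · refine (abs_le_of_sq_le_sq' ?_ (by linarith)).2
    nlinarith
  · refine (abs_le_of_sq_le_sq' ?_ (by linarith)).2
    nlinarith

theorem rpow_le_of_comparable {R s : ℝ} (hR : 0 < R) (h1 : R / 4 ≤ s) (h2 : s ≤ 4 * R) (r : ℝ) :
    s ^ r ≤ 4 ^ |r| * R ^ r := by
  rcases le_total 0 r with hr | hr
  · rw [abs_of_nonneg hr, ← Real.mul_rpow (by norm_num) hR.le]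
    exact Real.rpow_le_rpow (by linarith) h2 hr
  · rw [abs_of_nonpos hr, Real.rpow_neg (by norm_num), ← div_eq_inv_mul,
      ← Real.div_rpow hR.le (by norm_num)]
    exact Real.rpow_le_rpow_of_nonpos (by linarith) h1 hr

theorem exists_shell_cutoff (m k : ℕ) : ∃ K : ℝ, 0 < K ∧ ∀ R : ℝ, 0 < R →
    ∃ χ : Em m × Em k → ℝ, ContDiff ℝ 1 χ ∧ (∀ z, |χ z| ≤ 1) ∧
      (∀ z, R ^ 2 ≤ japaneseSq z → japaneseSq z ≤ 4 * R ^ 2 → χ z = 1) ∧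
      (∀ z, z ∉ shell m k R → χ z = 0 ∧ fderiv ℝ χ z = 0) ∧
      ∀ z, ‖fderiv ℝ χ z‖ ≤ K / R := by
  let b : ContDiffBump (5 / 2 : ℝ) := ⟨3 / 2, 2, by norm_num, by norm_num⟩
  obtain ⟨K, hK, hbK⟩ := exists_deriv_bound_contDiffBump b
  refine ⟨10 * K, by positivity, fun R hR => ?_⟩
  have hb0 : ∀ s : ℝ, ¬(1 / 2 ≤ s ∧ s ≤ 9 / 2) → b s = 0 := by
    intro s hs
    refine b.zero_of_le_dist ?_
    rw [Real.dist_eq]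
    by_contra h
    have h' : |s - 5 / 2| < 2 := not_le.1 h
    rw [abs_lt] at h'
    exact hs ⟨by linarith, by linarith⟩
  have hbd : ∀ s : ℝ, ¬(1 / 2 ≤ s ∧ s ≤ 9 / 2) → deriv b s = 0 := fun s hs =>
    IsLocalMin.deriv_eq_zero (Eventually.of_forall fun r => by rw [hb0 s hs]; exact b.nonneg)
  have hfd : ∀ z : Em m × Em k, fderiv ℝ (fun z => b (japaneseSq z / R ^ 2)) z
      = (deriv b (japaneseSq z / R ^ 2) / R ^ 2) • fderiv ℝ japaneseSq z := by
    intro z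
    have h1 := ((contDiff_japaneseSq (m := m) (k := k)).differentiable
      (by norm_num) z).hasFDerivAt
    have h2 : HasDerivAt (fun s : ℝ => s / R ^ 2) (1 / R ^ 2) (japaneseSq z) :=
      (hasDerivAt_id _).div_const _
    have h3 := (((b.contDiff (n := 1)).differentiable (by norm_num))
      (japaneseSq z / R ^ 2)).hasDerivAt
    have h4 := (HasDerivAt.comp (h₂ := b) (japaneseSq z) h3 h2).comp_hasFDerivAt z h1
    rw [show deriv b (japaneseSq z / R ^ 2) / R ^ 2
      = deriv b (japaneseSq z / R ^ 2) * (1 / R ^ 2) by ring]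
    exact h4.fderiv
  have hmem : ∀ z : Em m × Em k, z ∉ shell m k R →
      ¬(1 / 2 ≤ japaneseSq z / R ^ 2 ∧ japaneseSq z / R ^ 2 ≤ 9 / 2) := by
    rintro z hz ⟨h1, h2⟩
    rw [le_div_iff₀ (by positivity)] at h1
    rw [div_le_iff₀ (by positivity)] at h2
    exact hz ⟨by linarith, h2⟩
  refine ⟨fun z => b (japaneseSq z / R ^ 2), b.contDiff.comp (contDiff_japaneseSq.div_const _),
    fun z => ?_, fun z h1 h2 => ?_, fun z hz => ⟨hb0 _ (hmem z hz), ?_⟩, fun z => ?_⟩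
  · rw [abs_of_nonneg b.nonneg]; exact b.le_one
  · refine b.one_of_mem_closedBall ?_
    rw [Metric.mem_closedBall, Real.dist_eq, abs_le]
    have h1' : 1 ≤ japaneseSq z / R ^ 2 := by rw [le_div_iff₀ (by positivity)]; linarith
    have h2' : japaneseSq z / R ^ 2 ≤ 4 := by rw [div_le_iff₀ (by positivity)]; exact h2
    change -(3 / 2) ≤ _ ∧ _ ≤ 3 / 2
    constructor <;> linarith
  · rw [hfd, hbd _ (hmem z hz)]; simp
  · rw [hfd, norm_smul]
    by_cases hz : z ∈ shell m k R
    · have h1 : ‖fderiv ℝ japaneseSq z‖ ≤ 10 * R := by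
        refine (abs_le_of_sq_le_sq' ?_ (by positivity)).2
        have := norm_fderiv_japaneseSq_sq_le z
        have := hz.2
        nlinarith
      rw [Real.norm_eq_abs, abs_div, abs_of_pos (by positivity : 0 < R ^ 2)]
      calc _ ≤ K / R ^ 2 * (10 * R) := by gcongr; exact hbK _
        _ = _ := by field_simp
    · rw [hbd _ (hmem z hz)]
      simp only [zero_div, norm_zero, zero_mul]
      positivity

theorem energyDensity_mul_le {χ u : Em m × Em k → ℝ} {z : Em m × Em k} {a γ B M : ℝ}
    (hχ : DifferentiableAt ℝ χ z) (hu : DifferentiableAt ℝ u z) (hχ1 : |χ z| ≤ 1)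
    (hχd : ‖fderiv ℝ χ z‖ ≤ B) (ha0 : 0 ≤ a) (ha1 : a ≤ 1) (hM : a ^ 2 * ‖z.1‖ ^ (2 * γ) ≤ M) :
    energyDensity a γ (fun z => χ z * u z) z
      ≤ 2 * energyDensity 1 γ u z + 2 * (1 + M) * B ^ 2 * u z ^ 2 := by
  have hB : 0 ≤ B := (norm_nonneg _).trans hχd
  have hd : fderiv ℝ (fun z => χ z * u z) z = χ z • fderiv ℝ u z + u z • fderiv ℝ χ z :=
    fderiv_fun_mul hχ hu
  have key : ∀ {F : Type} [NormedAddCommGroup F] [NormedSpace ℝ F] (i : F →L[ℝ] Em m × Em k),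
      ‖i‖ ≤ 1 → ‖(fderiv ℝ (fun z => χ z * u z) z).comp i‖ ^ 2
        ≤ 2 * ‖(fderiv ℝ u z).comp i‖ ^ 2 + 2 * B ^ 2 * u z ^ 2 := by
    intro F _ _ i hi
    have h1 : ‖(fderiv ℝ (fun z => χ z * u z) z).comp i‖
        ≤ ‖(fderiv ℝ u z).comp i‖ + |u z| * B := by
      rw [hd, ContinuousLinearMap.add_comp, ContinuousLinearMap.smul_comp,
        ContinuousLinearMap.smul_comp]
      refine (norm_add_le _ _).trans ?_
      rw [norm_smul, norm_smul, Real.norm_eq_abs, Real.norm_eq_abs]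
      have h2 : ‖(fderiv ℝ χ z).comp i‖ ≤ B := by
        calc _ ≤ ‖fderiv ℝ χ z‖ * ‖i‖ := ContinuousLinearMap.opNorm_comp_le _ _
          _ ≤ B * 1 := by gcongr
          _ = B := mul_one B
      gcongr
      exact mul_le_of_le_one_left (norm_nonneg _) hχ1
    have h2 := pow_le_pow_left₀ (norm_nonneg _) h1 2
    have h3 : (|u z| * B) ^ 2 = B ^ 2 * u z ^ 2 := by rw [mul_pow, sq_abs]; ring
    nlinarith [sq_nonneg (‖(fderiv ℝ u z).comp i‖ - |u z| * B)]
  have hX := key (ContinuousLinearMap.inl ℝ (Em m) (Em k))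
    (ContinuousLinearMap.norm_inl_le_one ℝ (Em m) (Em k))
  have hY := key (ContinuousLinearMap.inr ℝ (Em m) (Em k))
    (ContinuousLinearMap.norm_inr_le_one ℝ (Em m) (Em k))
  have hw0 : 0 ≤ ‖z.1‖ ^ (2 * γ) := by positivity
  have hw1 : a ^ 2 * ‖z.1‖ ^ (2 * γ) ≤ 1 ^ 2 * ‖z.1‖ ^ (2 * γ) := by gcongr
  unfold energyDensity partialX partialY
  calc _ ≤ (2 * ‖(fderiv ℝ u z).comp (ContinuousLinearMap.inl ℝ (Em m) (Em k))‖ ^ 2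
        + 2 * B ^ 2 * u z ^ 2) + a ^ 2 * ‖z.1‖ ^ (2 * γ)
        * (2 * ‖(fderiv ℝ u z).comp (ContinuousLinearMap.inr ℝ (Em m) (Em k))‖ ^ 2
          + 2 * B ^ 2 * u z ^ 2) := by gcongr
    _ = 2 * ‖(fderiv ℝ u z).comp (ContinuousLinearMap.inl ℝ (Em m) (Em k))‖ ^ 2
        + 2 * (a ^ 2 * ‖z.1‖ ^ (2 * γ)
          * ‖(fderiv ℝ u z).comp (ContinuousLinearMap.inr ℝ (Em m) (Em k))‖ ^ 2)
        + 2 * (1 + a ^ 2 * ‖z.1‖ ^ (2 * γ)) * B ^ 2 * u z ^ 2 := by ring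
    _ ≤ 2 * ‖(fderiv ℝ u z).comp (ContinuousLinearMap.inl ℝ (Em m) (Em k))‖ ^ 2
        + 2 * (1 ^ 2 * ‖z.1‖ ^ (2 * γ)
          * ‖(fderiv ℝ u z).comp (ContinuousLinearMap.inr ℝ (Em m) (Em k))‖ ^ 2)
        + 2 * (1 + M) * B ^ 2 * u z ^ 2 := by gcongr
    _ = _ := by ring

/-- The energy density of `E_V^γ` for the model potential `C_V (1 + |z|)^{-α}`. -/
def modelDensity (γ C_V α : ℝ) (u : Em m × Em k → ℝ) (z : Em m × Em k) : ℝ :=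
  energyDensity 1 γ u z + C_V / (1 + pnorm z) ^ α * u z ^ 2

theorem one_add_pnorm_pos (z : Em m × Em k) : 0 < 1 + pnorm z := by
  have : 0 ≤ pnorm z := Real.sqrt_nonneg _
  linarith

theorem modelDensity_nonneg {γ C_V α : ℝ} (hCV : 0 < C_V) (u : Em m × Em k → ℝ)
    (z : Em m × Em k) : 0 ≤ modelDensity γ C_V α u z := by
  have := one_add_pnorm_pos z
  have := energyDensity_nonneg 1 γ u z
  unfold modelDensity
  positivity

theorem sq_le_modelDensity {γ C_V α R : ℝ} (hCV : 0 < C_V) (hR : 0 < R) (u : Em m × Em k → ℝ)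
    {z : Em m × Em k} (hz : z ∈ shell m k R) :
    u z ^ 2 ≤ 4 ^ |α| / C_V * R ^ α * modelDensity γ C_V α u z := by
  obtain ⟨h1, h2⟩ := one_add_pnorm_comparable hR hz
  have h3 := rpow_le_of_comparable hR h1 h2 α
  have hs := one_add_pnorm_pos z
  have hsα : 0 < (1 + pnorm z) ^ α := by positivity
  have hE := energyDensity_nonneg 1 γ u z
  calc u z ^ 2 = (1 + pnorm z) ^ α / C_V * (C_V / (1 + pnorm z) ^ α * u z ^ 2) := by field_simp
    _ ≤ (4 ^ |α| * R ^ α) / C_V * modelDensity γ C_V α u z := by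
        have : C_V / (1 + pnorm z) ^ α * u z ^ 2 ≤ modelDensity γ C_V α u z := by
          unfold modelDensity; linarith
        gcongr
    _ = _ := by ring

theorem rpow_neg_mul_norm_fst_rpow_le {γ R : ℝ} (hγ : 0 < γ) (hR : 0 < R) {z : Em m × Em k}
    (hz : z ∈ shell m k R) : (R ^ (-γ)) ^ 2 * ‖z.1‖ ^ (2 * γ) ≤ 4 ^ (2 * γ) := by
  have h1 : ‖z.1‖ ≤ 4 * R := by
    have h2 : ‖z.1‖ ≤ pnorm z := Real.le_sqrt_of_sq_le (by nlinarith [sq_nonneg ‖z.2‖])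
    have := (one_add_pnorm_comparable hR hz).2
    linarith
  have h3 : ‖z.1‖ ^ (2 * γ) ≤ 4 ^ (2 * γ) * R ^ (2 * γ) := by
    rw [← Real.mul_rpow (by norm_num) hR.le]
    exact Real.rpow_le_rpow (norm_nonneg _) h1 (by positivity)
  have h4 : (R ^ (-γ)) ^ 2 * R ^ (2 * γ) = 1 := by
    rw [← Real.rpow_natCast, ← Real.rpow_mul hR.le, ← Real.rpow_add hR]
    rw [show -γ * ((2 : ℕ) : ℝ) + 2 * γ = 0 by push_cast; ring, Real.rpow_zero]
  calc _ ≤ (R ^ (-γ)) ^ 2 * (4 ^ (2 * γ) * R ^ (2 * γ)) := by gcongr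
    _ = 4 ^ (2 * γ) * ((R ^ (-γ)) ^ 2 * R ^ (2 * γ)) := by ring
    _ = _ := by rw [h4, mul_one]

/-- On a shell of radius `R ≥ 1`, the cut-off function has controlled mass and energy. -/
theorem exists_shell_localization (m k : ℕ) {γ C_V : ℝ} (α : ℝ) (hγ : 0 < γ) (hCV : 0 < C_V) :
    ∃ C : ℝ, 0 < C ∧ ∀ {u : Em m × Em k → ℝ} {R : ℝ}, ContDiff ℝ 1 u → HasCompactSupport u →
      1 ≤ R → ∃ v : Em m × Em k → ℝ, ContDiff ℝ 1 v ∧ HasCompactSupport v ∧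
        (∀ z, R ^ 2 ≤ japaneseSq z → japaneseSq z ≤ 4 * R ^ 2 → v z = u z) ∧
        (∫⁻ z, ENNReal.ofReal (v z ^ 2) ≤ ENNReal.ofReal (C * R ^ max 2 α)
          * ∫⁻ z in shell m k R, ENNReal.ofReal (modelDensity γ C_V α u z)) ∧
        (∫⁻ z, ENNReal.ofReal (energyDensity (R ^ (-γ)) γ v z)
          ≤ ENNReal.ofReal (C * R ^ (max 2 α - 2))
          * ∫⁻ z in shell m k R, ENNReal.ofReal (modelDensity γ C_V α u z)) := by
  obtain ⟨K, hK, hcut⟩ := exists_shell_cutoff m k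
  set P : ℝ := 4 ^ |α| / C_V
  have hP : 0 < P := by positivity
  set M : ℝ := 4 ^ (2 * γ)
  have hM : 0 < M := by positivity
  refine ⟨P + 2 + 2 * (1 + M) * K ^ 2 * P, by positivity, fun {u R} hu hus hR => ?_⟩
  have hR0 : 0 < R := by linarith
  obtain ⟨χ, hχ, hχ1, hχeq, hχ0, hχd⟩ := hcut R hR0
  have hSm := measurableSet_shell (m := m) (k := k) R
  have hRα : R ^ α ≤ R ^ max 2 α := Real.rpow_le_rpow_of_exponent_le hR (le_max_right _ _)
  refine ⟨fun z => χ z * u z, hχ.mul hu, hus.mul_left, fun z h1 h2 => by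
    simp only; rw [hχeq z h1 h2, one_mul], ?_, ?_⟩
  · rw [← lintegral_const_mul' _ _ ENNReal.ofReal_ne_top, ← lintegral_indicator hSm]
    refine lintegral_mono fun z => ?_
    by_cases hz : z ∈ shell m k R
    · have hD := modelDensity_nonneg (γ := γ) (α := α) hCV u z
      rw [Set.indicator_of_mem hz, ← ENNReal.ofReal_mul (by positivity)]
      refine ENNReal.ofReal_le_ofReal ?_
      calc (χ z * u z) ^ 2 = |χ z| ^ 2 * u z ^ 2 := by rw [mul_pow, sq_abs]
        _ ≤ 1 ^ 2 * u z ^ 2 := by gcongr; exact hχ1 z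
        _ = u z ^ 2 := by ring
        _ ≤ P * R ^ α * modelDensity γ C_V α u z := sq_le_modelDensity hCV hR0 u hz
        _ ≤ _ := by
          gcongr
          have : 0 ≤ 2 + 2 * (1 + M) * K ^ 2 * P := by positivity
          linarith
    · simp [(hχ0 z hz).1]
  · rw [← lintegral_const_mul' _ _ ENNReal.ofReal_ne_top, ← lintegral_indicator hSm]
    refine lintegral_mono fun z => ?_
    have hχz := (hχ.differentiable (by norm_num)) z
    have huz := (hu.differentiable (by norm_num)) z
    by_cases hz : z ∈ shell m k R
    · have hD := modelDensity_nonneg (γ := γ) (α := α) hCV u z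
      rw [Set.indicator_of_mem hz, ← ENNReal.ofReal_mul (by positivity)]
      refine ENNReal.ofReal_le_ofReal ?_
      have hE : energyDensity 1 γ u z ≤ modelDensity γ C_V α u z := by
        have := one_add_pnorm_pos z
        unfold modelDensity
        have : 0 ≤ C_V / (1 + pnorm z) ^ α * u z ^ 2 := by positivity
        linarith
      have hR1 : 1 ≤ R ^ (max 2 α - 2) :=
        Real.one_le_rpow hR (by linarith [le_max_left 2 α])
      have hR2 : R ^ α / R ^ 2 ≤ R ^ (max 2 α - 2) := by
        rw [Real.rpow_sub hR0, Real.rpow_two]; gcongr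
      have ha1 : R ^ (-γ) ≤ 1 := Real.rpow_le_one_of_one_le_of_nonpos hR (by linarith)
      calc _ ≤ 2 * energyDensity 1 γ u z + 2 * (1 + M) * (K / R) ^ 2 * u z ^ 2 :=
            energyDensity_mul_le hχz huz (hχ1 z) (hχd z) (by positivity) ha1
              (rpow_neg_mul_norm_fst_rpow_le hγ hR0 hz)
        _ ≤ 2 * modelDensity γ C_V α u z
              + 2 * (1 + M) * (K / R) ^ 2 * (P * R ^ α * modelDensity γ C_V α u z) := by
            gcongr
            exact sq_le_modelDensity hCV hR0 u hz
        _ = (2 * 1 + 2 * (1 + M) * K ^ 2 * P * (R ^ α / R ^ 2)) * modelDensity γ C_V α u z := by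
            field_simp
        _ ≤ (2 * R ^ (max 2 α - 2) + 2 * (1 + M) * K ^ 2 * P * R ^ (max 2 α - 2))
              * modelDensity γ C_V α u z := by gcongr
        _ = (2 + 2 * (1 + M) * K ^ 2 * P) * R ^ (max 2 α - 2) * modelDensity γ C_V α u z := by
            ring
        _ ≤ _ := by gcongr; linarith
    · have hd : fderiv ℝ (fun z => χ z * u z) z = 0 := by
        rw [fderiv_fun_mul hχz huz, (hχ0 z hz).1, (hχ0 z hz).2]; simp
      simp [energyDensity, partialX, partialY, hd]

theorem exists_lintegral_shell_le (hm : 1 ≤ m) (k : ℕ) {γ C_V : ℝ} (α : ℝ) (hγ : 0 < γ)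
    (hCV : 0 < C_V) (hν : 2 < (m : ℝ) + (γ + 1) * k) {p : ℝ} (hp : 2 ≤ p)
    (hpq : p ≤ twoStar m k γ) :
    ∃ C : ℝ, 0 < C ∧ ∀ {u : Em m × Em k → ℝ} {R : ℝ}, ContDiff ℝ 1 u → HasCompactSupport u →
      1 ≤ R → ∫⁻ z in {z | R ^ 2 ≤ japaneseSq z ∧ japaneseSq z < 4 * R ^ 2},
          ENNReal.ofReal (|u z| ^ p)
        ≤ ENNReal.ofReal (C * R ^ (((m : ℝ) + k) - ((m : ℝ) + k) * (p / 2) + max 2 α * (p / 2)))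
          * (∫⁻ z in shell m k R, ENNReal.ofReal (modelDensity γ C_V α u z)) ^ (p / 2) := by
  obtain ⟨C₁, hC₁, hloc⟩ := exists_shell_localization m k α hγ hCV
  obtain ⟨C₂, hC₂, hsob⟩ := exists_lintegral_twoStar_le hm k hγ hν
  set ν : ℝ := (m : ℝ) + (γ + 1) * k with hνdef
  set q : ℝ := twoStar m k γ with hqdef
  have hq : q = 2 * ν / (ν - 2) := rfl
  have hν2 : 0 < ν - 2 := by linarith
  have hq2 : q - 2 = 4 / (ν - 2) := by rw [hq]; field_simp; ring
  have hq2' : 0 < q - 2 := by rw [hq2]; positivity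
  have hq0 : 0 < q := by linarith
  set θ : ℝ := (q - p) / (q - 2) with hθdef
  set θ' : ℝ := (p - 2) / (q - 2) with hθdef'
  have hθ : 0 ≤ θ := div_nonneg (by linarith) hq2'.le
  have hθ' : 0 ≤ θ' := div_nonneg (by linarith) hq2'.le
  have hθp : θ + q / 2 * θ' = p / 2 := by rw [hθdef, hθdef']; field_simp; ring
  refine ⟨C₁ ^ θ * (C₂ * C₁) ^ (q / 2 * θ'), by positivity, fun {u R} hu hus hR => ?_⟩
  have hR0 : 0 < R := by linarith
  obtain ⟨v, hv, hvs, hveq, hv2, hvE⟩ := hloc hu hus hR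
  set D := ∫⁻ z in shell m k R, ENNReal.ofReal (modelDensity γ C_V α u z)
  set μ : ℝ := max 2 α
  have hAm : MeasurableSet {z : Em m × Em k | R ^ 2 ≤ japaneseSq z ∧ japaneseSq z < 4 * R ^ 2} :=
    (measurableSet_le measurable_const contDiff_japaneseSq.continuous.measurable).inter
      (measurableSet_lt contDiff_japaneseSq.continuous.measurable measurable_const)
  set e : ℝ := -(2 * k / ν) * -γ + (μ - 2) with he
  have hvq : ∫⁻ z, ENNReal.ofReal (|v z| ^ q)
      ≤ (ENNReal.ofReal (C₂ * C₁ * R ^ e) * D) ^ (q / 2) := by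
    have h1 := hsob hv hvs (a := R ^ (-γ)) (by positivity)
    have h2 := h1.trans (mul_le_mul_right hvE _)
    rw [← mul_assoc, ← ENNReal.ofReal_mul (by positivity)] at h2
    have h3 : C₂ * (R ^ (-γ)) ^ (-(2 * k / ν)) * (C₁ * R ^ (μ - 2)) = C₂ * C₁ * R ^ e := by
      rw [← Real.rpow_mul hR0.le, he, Real.rpow_add hR0, mul_comm (-γ)]; ring
    rw [h3] at h2
    have h4 := ENNReal.rpow_le_rpow h2 (by positivity : 0 ≤ q / 2)
    rwa [← ENNReal.rpow_mul, show 2 / q * (q / 2) = 1 by field_simp, ENNReal.rpow_one] at h4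
  calc _ ≤ ∫⁻ z, ENNReal.ofReal (|v z| ^ p) := by
        rw [← lintegral_indicator hAm]
        refine lintegral_mono fun z => ?_
        by_cases hz : R ^ 2 ≤ japaneseSq z ∧ japaneseSq z < 4 * R ^ 2
        · rw [Set.indicator_of_mem (by exact hz), hveq z hz.1 hz.2.le]
        · rw [Set.indicator_of_notMem (by exact hz)]; exact zero_le
    _ ≤ _ := lintegral_abs_rpow_interpolation volume hv.continuous.measurable hp hpq
        (by linarith)
    _ ≤ (ENNReal.ofReal (C₁ * R ^ μ) * D) ^ θ
          * ((ENNReal.ofReal (C₂ * C₁ * R ^ e) * D) ^ (q / 2)) ^ θ' := by gcongr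
    _ = ENNReal.ofReal ((C₁ * R ^ μ) ^ θ * (C₂ * C₁ * R ^ e) ^ (q / 2 * θ'))
          * (D ^ θ * D ^ (q / 2 * θ')) := by
        rw [← ENNReal.rpow_mul, ENNReal.mul_rpow_of_nonneg _ _ hθ,
          ENNReal.mul_rpow_of_nonneg _ _ (by positivity),
          ENNReal.ofReal_rpow_of_pos (by positivity), ENNReal.ofReal_rpow_of_pos (by positivity),
          ENNReal.ofReal_mul (by positivity)]
        ring
    _ = _ := by
        rw [← ENNReal.rpow_add_of_nonneg _ _ hθ (by positivity), hθp]
        congr 2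
        rw [Real.mul_rpow (by positivity) (by positivity),
          Real.mul_rpow (by positivity) (by positivity), ← Real.rpow_mul hR0.le,
          ← Real.rpow_mul hR0.le]
        rw [show C₁ ^ θ * R ^ (μ * θ) * ((C₂ * C₁) ^ (q / 2 * θ') * R ^ (e * (q / 2 * θ')))
          = C₁ ^ θ * (C₂ * C₁) ^ (q / 2 * θ') * (R ^ (μ * θ) * R ^ (e * (q / 2 * θ'))) by ring,
          ← Real.rpow_add hR0]
        congr 2
        have h5 : θ = p / 2 - q / 2 * θ' := by linarith
        have h6 : q / 2 * θ' = ν * (p - 2) / 4 := by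
          rw [hθdef', hq2, hq]; field_simp
        rw [h5, h6, he]
        field_simp
        rw [hνdef]
        ring

theorem disjoint_shell_two_pow {i j : ℕ} (hij : i + 2 ≤ j) :
    Disjoint (shell m k (2 ^ i)) (shell m k (2 ^ j)) := by
  rw [Set.disjoint_left]
  rintro z ⟨-, h1⟩ ⟨h2, -⟩
  have h3 : (2 : ℝ) ^ (i + 2) ≤ 2 ^ j := pow_le_pow_right₀ (by norm_num) hij
  rw [pow_add] at h3
  have h4 : (0 : ℝ) < 2 ^ i := by positivity
  nlinarith

theorem tsum_setLIntegral_shell_le (f : Em m × Em k → ENNReal) :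
    ∑' j : ℕ, ∫⁻ z in shell m k (2 ^ j), f z ≤ 2 * ∫⁻ z, f z := by
  have key : ∀ e : ℕ → ℕ, (∀ i j, i < j → e i + 2 ≤ e j) →
      ∑' j : ℕ, ∫⁻ z in shell m k (2 ^ e j), f z ≤ ∫⁻ z, f z := by
    intro e he
    have hd : Pairwise (Function.onFun Disjoint fun j => shell m k (2 ^ e j)) := by
      intro i j hij
      rcases lt_or_gt_of_ne hij with h | h
      · exact disjoint_shell_two_pow (he i j h)
      · exact (disjoint_shell_two_pow (he j i h)).symm
    rw [← lintegral_iUnion (fun j => measurableSet_shell _) hd]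
    exact setLIntegral_le_lintegral _ _
  have h := HasSum.even_add_odd
    (f := fun j : ℕ => ∫⁻ z in shell m k (2 ^ j), f z)
    (ENNReal.summable (f := fun j : ℕ => ∫⁻ z in shell m k (2 ^ (2 * j)), f z)).hasSum
    (ENNReal.summable (f := fun j : ℕ => ∫⁻ z in shell m k (2 ^ (2 * j + 1)), f z)).hasSum
  rw [h.tsum_eq, two_mul]
  exact add_le_add (key (fun j => 2 * j) fun i j h => by omega)
    (key (fun j => 2 * j + 1) fun i j h => by omega)

theorem ENNReal.tsum_rpow_le_rpow_tsum {ι : Type*} (D : ι → ENNReal) {r : ℝ} (hr : 1 ≤ r) :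
    ∑' i, D i ^ r ≤ (∑' i, D i) ^ r := by
  have hsplit : ∀ x : ENNReal, x ^ r = x * x ^ (r - 1) := by
    intro x
    rw [show r = 1 + (r - 1) by ring,
      ENNReal.rpow_add_of_nonneg _ _ zero_le_one (by linarith), ENNReal.rpow_one]
    norm_num
  calc ∑' i, D i ^ r ≤ ∑' i, D i * (∑' i, D i) ^ (r - 1) := by
        refine ENNReal.tsum_le_tsum fun i => ?_
        rw [hsplit]
        gcongr
        exact ENNReal.le_tsum i
    _ = _ := by rw [ENNReal.tsum_mul_right, ← hsplit]

theorem iUnion_japaneseSq_annulus :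
    ⋃ j : ℕ, {z : Em m × Em k | ((2 : ℝ) ^ j) ^ 2 ≤ japaneseSq z
      ∧ japaneseSq z < 4 * ((2 : ℝ) ^ j) ^ 2} = Set.univ := by
  refine Set.eq_univ_of_forall fun z => Set.mem_iUnion.2 ?_
  obtain ⟨j, h1, h2⟩ := exists_nat_pow_near (one_le_japaneseSq z) (by norm_num : (1 : ℝ) < 4)
  have h4 : ((2 : ℝ) ^ j) ^ 2 = 4 ^ j := by rw [← pow_mul, mul_comm, pow_mul]; norm_num
  refine ⟨j, ?_, ?_⟩
  · rw [h4]; exact h1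
  · rw [h4, ← pow_succ']; exact h2

/-- The embedding inequality for the model weights `(1 + |z|)^{-α}` and `(1 + |z|)^{-β}`. -/
theorem exists_lintegral_model_le (hm : 1 ≤ m) (k : ℕ) {γ C_V C_Q α β p : ℝ} (hγ : 0 < γ)
    (hCV : 0 < C_V) (hCQ : 0 < C_Q) (hν : 2 < (m : ℝ) + (γ + 1) * k) (hp : 2 ≤ p)
    (hpq : p ≤ twoStar m k γ)
    (hexp : ((m : ℝ) + k) - β - ((m : ℝ) + k) * (p / 2) + max 2 α * (p / 2) ≤ 0) :
    ∃ C : ℝ, 0 < C ∧ ∀ {u : Em m × Em k → ℝ}, ContDiff ℝ 1 u → HasCompactSupport u →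
      ∫⁻ z, ENNReal.ofReal (C_Q / (1 + pnorm z) ^ β * |u z| ^ p)
        ≤ ENNReal.ofReal C * (∫⁻ z, ENNReal.ofReal (modelDensity γ C_V α u z)) ^ (p / 2) := by
  obtain ⟨C, hC, hsh⟩ := exists_lintegral_shell_le hm k α hγ hCV hν hp hpq
  refine ⟨C_Q * 4 ^ |-β| * C * 2 ^ (p / 2), by positivity, fun {u} hu hus => ?_⟩
  set F : Em m × Em k → ENNReal := fun z => ENNReal.ofReal (C_Q / (1 + pnorm z) ^ β * |u z| ^ p)
    with hF
  set D : ℕ → ENNReal := fun j =>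
    ∫⁻ z in shell m k (2 ^ j), ENNReal.ofReal (modelDensity γ C_V α u z) with hD
  set A : ℕ → Set (Em m × Em k) := fun j =>
    {z | ((2 : ℝ) ^ j) ^ 2 ≤ japaneseSq z ∧ japaneseSq z < 4 * ((2 : ℝ) ^ j) ^ 2} with hA
  have hpiece : ∀ j, ∫⁻ z in A j, F z
      ≤ ENNReal.ofReal (C_Q * 4 ^ |-β| * C) * D j ^ (p / 2) := by
    intro j
    set R : ℝ := 2 ^ j
    have hR : 1 ≤ R := one_le_pow₀ (by norm_num)
    have hR0 : 0 < R := by linarith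
    have hAm : MeasurableSet (A j) :=
      (measurableSet_le measurable_const contDiff_japaneseSq.continuous.measurable).inter
        (measurableSet_lt contDiff_japaneseSq.continuous.measurable measurable_const)
    have hRe : R ^ (-β) * R ^ (((m : ℝ) + k) - ((m : ℝ) + k) * (p / 2) + max 2 α * (p / 2))
        ≤ 1 := by
      rw [← Real.rpow_add hR0]
      exact Real.rpow_le_one_of_one_le_of_nonpos hR (by linarith)
    calc ∫⁻ z in A j, F z
        ≤ ∫⁻ z in A j, ENNReal.ofReal (C_Q * 4 ^ |-β| * R ^ (-β))
            * ENNReal.ofReal (|u z| ^ p) := by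
          refine setLIntegral_mono' hAm fun z hz => ?_
          have hz1 : R ^ 2 ≤ japaneseSq z := hz.1
          have hz2 : japaneseSq z < 4 * R ^ 2 := hz.2
          have hzs : z ∈ shell m k R := ⟨by nlinarith, by nlinarith⟩
          obtain ⟨h1, h2⟩ := one_add_pnorm_comparable hR0 hzs
          have h3 := rpow_le_of_comparable hR0 h1 h2 (-β)
          have hpos := one_add_pnorm_pos z
          rw [hF, ← ENNReal.ofReal_mul (by positivity)]
          refine ENNReal.ofReal_le_ofReal ?_
          rw [div_eq_mul_inv, ← Real.rpow_neg hpos.le, mul_assoc C_Q (4 ^ |-β|)]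
          gcongr
      _ = ENNReal.ofReal (C_Q * 4 ^ |-β| * R ^ (-β))
            * ∫⁻ z in A j, ENNReal.ofReal (|u z| ^ p) :=
          lintegral_const_mul' _ _ ENNReal.ofReal_ne_top
      _ ≤ ENNReal.ofReal (C_Q * 4 ^ |-β| * R ^ (-β))
            * (ENNReal.ofReal
              (C * R ^ (((m : ℝ) + k) - ((m : ℝ) + k) * (p / 2) + max 2 α * (p / 2)))
              * D j ^ (p / 2)) := mul_le_mul_right (hsh hu hus hR) _
      _ ≤ _ := by
          rw [← mul_assoc, ← ENNReal.ofReal_mul (by positivity)]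
          refine mul_le_mul_left (ENNReal.ofReal_le_ofReal ?_) _
          calc _ = C_Q * 4 ^ |-β| * C * (R ^ (-β)
                * R ^ (((m : ℝ) + k) - ((m : ℝ) + k) * (p / 2) + max 2 α * (p / 2))) := by ring
            _ ≤ C_Q * 4 ^ |-β| * C * 1 := by gcongr
            _ = _ := mul_one _
  calc ∫⁻ z, F z = ∫⁻ z in ⋃ j, A j, F z := by
        rw [hA, iUnion_japaneseSq_annulus, Measure.restrict_univ]
    _ ≤ ∑' j, ∫⁻ z in A j, F z := lintegral_iUnion_le _ _
    _ ≤ ∑' j, ENNReal.ofReal (C_Q * 4 ^ |-β| * C) * D j ^ (p / 2) :=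
        ENNReal.tsum_le_tsum hpiece
    _ = ENNReal.ofReal (C_Q * 4 ^ |-β| * C) * ∑' j, D j ^ (p / 2) := ENNReal.tsum_mul_left
    _ ≤ ENNReal.ofReal (C_Q * 4 ^ |-β| * C) * (∑' j, D j) ^ (p / 2) :=
        mul_le_mul_right (ENNReal.tsum_rpow_le_rpow_tsum D (by linarith)) _
    _ ≤ ENNReal.ofReal (C_Q * 4 ^ |-β| * C)
          * (2 * ∫⁻ z, ENNReal.ofReal (modelDensity γ C_V α u z)) ^ (p / 2) :=
        mul_le_mul_right
          (ENNReal.rpow_le_rpow (tsum_setLIntegral_shell_le _) (by linarith)) _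
    _ = _ := by
        rw [ENNReal.mul_rpow_of_nonneg _ _ (by linarith), ← mul_assoc,
          ENNReal.ofReal_mul (q := 2 ^ (p / 2)) (by positivity),
          ← ENNReal.ofReal_rpow_of_pos (by norm_num), ENNReal.ofReal_ofNat]

end Grushin

/-- Weighted Sobolev embedding, case (iii): under (V), (Q) with
`α ≤ N`, `β_ ≤ β < N` where
`β_ = max{N - 2*_γ(N-2)/2, N - 2*_γ(N-α)/2}`, and
`p_ ≤ p ≤ 2*_γ` where `p_ = max{2, 2(N-β)/(N-2), 2(N-β)/(N-α)}`,
there is `C > 0` with `(∫ Q|u|^p)^{1/p} ≤ C ‖u‖_{E_V^γ}` for all `u ∈ C_c^∞(ℝ^N)`. -/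
theorem weighted_embedding_case_iii (m k : ℕ) (hm : 1 ≤ m) (hk : 1 ≤ k) (hN : 3 ≤ m + k)
    (γ : ℝ) (hγ : 0 < γ)
    (V Q : Em m × Em k → ℝ) (hVmeas : Measurable V) (hQmeas : Measurable Q)
    (C_V C_Q α β : ℝ) (hCV : 0 < C_V) (hCQ : 0 < C_Q)
    (hV : ∀ᵐ z ∂(volume : Measure (Em m × Em k)), C_V / (1 + pnorm z) ^ α ≤ V z)
    (hQ : ∀ᵐ z ∂(volume : Measure (Em m × Em k)), 0 < Q z ∧ Q z ≤ C_Q / (1 + pnorm z) ^ β)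
    (hα : α ≤ ((m : ℝ) + k))
    (hβlow : max (((m : ℝ) + k) - twoStar m k γ * (((m : ℝ) + k) - 2) / 2)
        (((m : ℝ) + k) - twoStar m k γ * (((m : ℝ) + k) - α) / 2) ≤ β)
    (hβ : β < ((m : ℝ) + k))
    (p : ℝ)
    (hp1 : max 2 (max (2 * (((m : ℝ) + k) - β) / (((m : ℝ) + k) - 2))
        (2 * (((m : ℝ) + k) - β) / (((m : ℝ) + k) - α))) ≤ p)
    (hp2 : p ≤ twoStar m k γ) :
    ∃ C : ℝ, 0 < C ∧ ∀ u : Em m × Em k → ℝ, ContDiff ℝ (⊤ : ℕ∞) u → HasCompactSupport u →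
      (∫⁻ z, ENNReal.ofReal (Q z * |u z| ^ p)) ^ (1 / p)
        ≤ ENNReal.ofReal C *
          (∫⁻ z, ENNReal.ofReal (grushinSq γ u z + V z * u z ^ 2)) ^ ((1:ℝ) / 2) := by
  have hNR : (3 : ℝ) ≤ (m : ℝ) + k := by exact_mod_cast hN
  have hkR : (1 : ℝ) ≤ k := by exact_mod_cast hk
  have hν : 2 < (m : ℝ) + (γ + 1) * k := by nlinarith
  have hαN : α < (m : ℝ) + k := by
    refine lt_of_le_of_ne hα fun h => ?_
    have h1 := (le_max_right _ _).trans hβlow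
    rw [h, sub_self, mul_zero, zero_div, sub_zero] at h1
    linarith
  have hp : 2 ≤ p := (le_max_left _ _).trans hp1
  have hpN := (le_max_left _ _).trans ((le_max_right _ _).trans hp1)
  have hpα := (le_max_right _ _).trans ((le_max_right _ _).trans hp1)
  rw [div_le_iff₀ (by linarith)] at hpN hpα
  have hexp : ((m : ℝ) + k) - β - ((m : ℝ) + k) * (p / 2) + max 2 α * (p / 2) ≤ 0 := by
    rcases max_choice 2 α with h | h <;> rw [h] <;> linarith
  obtain ⟨C, hC, hmodel⟩ := exists_lintegral_model_le hm k hγ hCV hCQ hν hp hp2 hexp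
  refine ⟨C ^ (1 / p), by positivity, fun u hu hus => ?_⟩
  have hu1 : ContDiff ℝ 1 u := hu.of_le (by exact_mod_cast le_top)
  have hQint : ∫⁻ z, ENNReal.ofReal (Q z * |u z| ^ p)
      ≤ ∫⁻ z, ENNReal.ofReal (C_Q / (1 + pnorm z) ^ β * |u z| ^ p) := by
    refine lintegral_mono_ae ?_
    filter_upwards [hQ] with z hz
    exact ENNReal.ofReal_le_ofReal (mul_le_mul_of_nonneg_right hz.2 (by positivity))
  have hVint : ∫⁻ z, ENNReal.ofReal (modelDensity γ C_V α u z)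
      ≤ ∫⁻ z, ENNReal.ofReal (grushinSq γ u z + V z * u z ^ 2) := by
    refine lintegral_mono_ae ?_
    filter_upwards [hV] with z hz
    refine ENNReal.ofReal_le_ofReal ?_
    rw [grushinSq_eq_energyDensity γ ((hu1.differentiable (by norm_num)) z)]
    exact add_le_add_right (mul_le_mul_of_nonneg_right hz (sq_nonneg _)) _
  set T := ∫⁻ z, ENNReal.ofReal (grushinSq γ u z + V z * u z ^ 2)
  calc (∫⁻ z, ENNReal.ofReal (Q z * |u z| ^ p)) ^ (1 / p)
      ≤ (ENNReal.ofReal C * T ^ (p / 2)) ^ (1 / p) := by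
        refine ENNReal.rpow_le_rpow ?_ (by positivity)
        refine hQint.trans ((hmodel hu1 hus).trans (mul_le_mul_right ?_ _))
        exact ENNReal.rpow_le_rpow hVint (by linarith)
    _ = ENNReal.ofReal (C ^ (1 / p)) * T ^ ((1 : ℝ) / 2) := by
        rw [ENNReal.mul_rpow_of_nonneg _ _ (by positivity), ENNReal.ofReal_rpow_of_pos hC,
          ← ENNReal.rpow_mul, show p / 2 * (1 / p) = 1 / 2 by field_simp]
end
end
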